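/- arXiv:1302.0454 — 2 statements merged into one kernel-verified Lean document; each statement's English description precedes it below -/
import Mathlib

section
/- Let P be any non-empty Π⁰₁ class, and let c be a cost function satisfying the limit condition. Then there is a Δ⁰₂ set Z ∈ P such that every computably enumerable set A with A ≤_T Z obeys c. -/
/-! Basic definitions: Cantor space, initial segments, computable approximations,
Martin-Löf randomness, change counting, cost functions, oracle computability. -/

/-- The length-`n` initial segment of `Z : ℕ → Bool`, as a list of booleans. -/
def restr (Z : ℕ → Bool) (n : ℕ) : List Bool := (List.range n).map Z

/-- `σ` is an initial segment of `Z`. -/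
def InitSeg (σ : List Bool) (Z : ℕ → Bool) : Prop := σ = restr Z σ.length

/-- `Z` is Martin-Löf random: for every computable sequence of strings with
finite total measure, only finitely many are initial segments of `Z`. -/
def MLRandom (Z : ℕ → Bool) : Prop :=
  ∀ σ : ℕ → List Bool, Computable σ →
    Summable (fun i => ((1 : ℝ) / 2) ^ (σ i).length) →
    {i | InitSeg (σ i) Z}.Finite

/-- `(Zs s) s∈ℕ` converges pointwise to `Z`. -/
def Approx (Zs : ℕ → ℕ → Bool) (Z : ℕ → Bool) : Prop :=
  ∀ x, ∃ t, ∀ s, t ≤ s → Zs s x = Z x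

/-- `Zs` is a computable approximation of `Z`. -/
def CompApprox (Zs : ℕ → ℕ → Bool) (Z : ℕ → Bool) : Prop :=
  Computable₂ Zs ∧ Approx Zs Z

/-- `Z` is Δ⁰₂: it has a computable approximation. -/
def Delta02 (Z : ℕ → Bool) : Prop := ∃ Zs, CompApprox Zs Z

/-- The set of stages `s ≥ 1` at which the length-`n` initial segment of the
approximation changes. -/
def changeStages (Zs : ℕ → ℕ → Bool) (n : ℕ) : Set ℕ :=
  {s | 1 ≤ s ∧ restr (Zs s) n ≠ restr (Zs (s - 1)) n}

/-- `Z` is a `g`-change set. -/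
def GChangeSet (Z : ℕ → Bool) (g : ℕ → ℕ) : Prop :=
  ∃ Zs, CompApprox Zs Z ∧
    ∀ n, (changeStages Zs n).Finite ∧ (changeStages Zs n).ncard ≤ g n

/-- `Z` is ω-c.a.: a `g`-change set for some computable `g`. -/
def OmegaCA (Z : ℕ → Bool) : Prop := ∃ g : ℕ → ℕ, Computable g ∧ GChangeSet Z g

/-- Lexicographic order on Cantor space. -/
def LexLE (X Y : ℕ → Bool) : Prop :=
  X = Y ∨ ∃ n, (∀ i, i < n → X i = Y i) ∧ X n = false ∧ Y n = true

/-- `Z` is left-c.e. -/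
def LeftCE (Z : ℕ → Bool) : Prop :=
  ∃ Zs, CompApprox Zs Z ∧ ∀ s, LexLE (Zs s) (Zs (s + 1))

/-- `c` is a cost function: computable, nonnegative, nondecreasing in the stage,
nonincreasing in the number. -/
def CostFunction (c : ℕ → ℕ → ℚ) : Prop :=
  Computable₂ c ∧ (∀ x s, 0 ≤ c x s) ∧
    (∀ x s t, s ≤ t → c x s ≤ c x t) ∧ (∀ x y s, x ≤ y → c y s ≤ c x s)

/-- The limit condition for a cost function. -/
def LimitCondition (c : ℕ → ℕ → ℚ) : Prop :=
  ∀ ε : ℚ, 0 < ε → ∃ x₀, ∀ x, x₀ ≤ x → ∀ s, c x s ≤ ε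

/-- A benign cost function: the number of pairwise disjoint intervals `[x,s)` with
`c x s ≥ 2^{-k}` is computably bounded in `k`. -/
def Benign (c : ℕ → ℕ → ℚ) : Prop :=
  ∃ b : ℕ → ℕ, Computable b ∧
    ∀ k m (x s : ℕ → ℕ), (∀ i, i < m → x i < s i) →
      (∀ i, i + 1 < m → s i ≤ x (i + 1)) →
      (∀ i, i < m → ((1 : ℚ) / 2) ^ k ≤ c (x i) (s i)) → m ≤ b k

open Classical in
/-- The cost paid at stage `s` by the approximation `As`: if `s ≥ 1` and the
approximation changes at `s`, it is `c x s` where `x` is the least changed number. -/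
noncomputable def stageCost (c : ℕ → ℕ → ℚ) (As : ℕ → ℕ → Bool) (s : ℕ) : ℚ :=
  if s = 0 then 0
  else if h : ∃ x, As s x ≠ As (s - 1) x then c (Nat.find h) s else 0

/-- `A` obeys the cost function `c`: some computable approximation of `A` has
finite total cost. -/
def Obeys (A : ℕ → Bool) (c : ℕ → ℕ → ℚ) : Prop :=
  ∃ As, CompApprox As A ∧ ∃ B : ℚ, ∀ F : Finset ℕ, ∑ s ∈ F, stageCost c As s ≤ B

/-- Functions partial recursive in the oracle `O`. -/
inductive RecIn (O : ℕ →. ℕ) : (ℕ →. ℕ) → Prop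
  | oracle : RecIn O O
  | zero : RecIn O (pure 0)
  | succ : RecIn O ↑Nat.succ
  | left : RecIn O ↑fun n : ℕ => n.unpair.1
  | right : RecIn O ↑fun n : ℕ => n.unpair.2
  | pair {f g} : RecIn O f → RecIn O g → RecIn O fun n => Nat.pair <$> f n <*> g n
  | comp {f g} : RecIn O f → RecIn O g → RecIn O fun n => g n >>= f
  | prec {f g} : RecIn O f → RecIn O g → RecIn O (Nat.unpaired fun a n =>
      n.rec (f a) fun y IH => do let i ← IH; g (Nat.pair a (Nat.pair y i)))
  | rfind {f} : RecIn O f → RecIn O fun a =>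
      Nat.rfind fun n => (fun m => m = 0) <$> f (Nat.pair a n)

/-- The characteristic function of `A` as a partial function ℕ →. ℕ. -/
def charFn (A : ℕ → Bool) : ℕ →. ℕ := fun n => Part.some (cond (A n) 1 0)

/-- Turing reducibility: `A ≤_T Z`. -/
def TuringLE (A Z : ℕ → Bool) : Prop := RecIn (charFn Z) (charFn A)

/-- `A` is computably enumerable: the domain of a partial computable function. -/
def CE (A : ℕ → Bool) : Prop :=
  ∃ f : ℕ →. ℕ, Nat.Partrec f ∧ ∀ x, A x = true ↔ (f x).Dom

/-- A Π⁰₁ class of elements of Cantor space. -/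
def Pi01 (P : Set (ℕ → Bool)) : Prop :=
  ∃ f : ℕ → Option (List Bool), Computable f ∧
    P = {Z | ∀ i σ, f i = some σ → ¬ InitSeg σ Z}

/-- The c.e. set `W_e`: the domain of the `e`-th partial computable function. -/
def Wset (e : ℕ) : Set ℕ :=
  {x | ((Denumerable.ofNat Nat.Partrec.Code e).eval x).Dom}

/-- The stage-`s` approximation to `W_e`, via step-bounded evaluation. -/
def WAt (e s x : ℕ) : Prop :=
  (Nat.Partrec.Code.evaln s (Denumerable.ofNat Nat.Partrec.Code e) x).isSome

/-- `A` is promptly simple. -/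
def PromptlySimple (A : ℕ → Bool) : Prop :=
  CE A ∧ {x | A x = false}.Infinite ∧
    ∃ As : ℕ → ℕ → Bool, Computable₂ As ∧
      (∀ s x, As s x = true → As (s + 1) x = true) ∧
      (∀ x, A x = true ↔ ∃ s, As s x = true) ∧
      ∀ e, (Wset e).Infinite →
        ∃ s x, 1 ≤ s ∧ WAt e s x ∧ ¬ WAt e (s - 1) x ∧ As s x = true

namespace PO

/-- Bounded existential search. -/
def bEx (n : ℕ) (p : ℕ → Bool) : Bool := Nat.rec false (fun k b => b || p k) n

theorem bEx_iff (n : ℕ) (p : ℕ → Bool) : bEx n p = true ↔ ∃ k < n, p k = true := by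
  induction n with
  | zero => simp [bEx]
  | succ n ih =>
    have : bEx (n+1) p = (bEx n p || p n) := rfl
    rw [this, Bool.or_eq_true, ih]
    constructor
    · rintro (⟨k, hk, h⟩ | h)
      · exact ⟨k, by omega, h⟩
      · exact ⟨n, by omega, h⟩
    · rintro ⟨k, hk, h⟩
      by_cases hkn : k = n
      · right; exact hkn ▸ h
      · left; exact ⟨k, by omega, h⟩

/-- Bounded universal search. -/
def bAll (n : ℕ) (p : ℕ → Bool) : Bool := !(bEx n (fun k => !(p k)))

theorem bAll_iff (n : ℕ) (p : ℕ → Bool) : bAll n p = true ↔ ∀ k < n, p k = true := by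
  unfold bAll
  rw [Bool.not_eq_true', ← Bool.not_eq_true, bEx_iff]
  simp

variable {α β γ δ : Type*} [Primcodable α] [Primcodable β] [Primcodable γ] [Primcodable δ]

theorem c_not {f : α → Bool} (hf : Computable f) : Computable fun a => !(f a) :=
  Primrec.not.to_comp.comp hf

theorem c_and {f g : α → Bool} (hf : Computable f) (hg : Computable g) :
    Computable fun a => f a && g a :=
  Primrec.and.to_comp.comp hf hg

theorem c_or {f g : α → Bool} (hf : Computable f) (hg : Computable g) :
    Computable fun a => f a || g a :=
  Primrec.or.to_comp.comp hf hg

theorem c_bEx {n : α → ℕ} {p : α → ℕ → Bool} (hn : Computable n)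
    (hp : Computable fun q : α × ℕ => p q.1 q.2) : Computable fun a => bEx (n a) (p a) := by
  have := Computable.nat_rec (f := n) (g := fun _ : α => false)
    (h := fun a q => q.2 || p a q.1) hn (Computable.const false)
    (c_or (Computable.snd.comp Computable.snd)
      (hp.comp (Computable.pair Computable.fst (Computable.fst.comp Computable.snd))))
  exact this.of_eq fun a => rfl

theorem c_bAll {n : α → ℕ} {p : α → ℕ → Bool} (hn : Computable n)
    (hp : Computable fun q : α × ℕ => p q.1 q.2) : Computable fun a => bAll (n a) (p a) :=
  c_not (c_bEx (p := fun a k => !(p a k)) hn (c_not hp))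

theorem c_add {f g : α → ℕ} (hf : Computable f) (hg : Computable g) :
    Computable fun a => f a + g a := Primrec.nat_add.to_comp.comp hf hg
theorem c_sub {f g : α → ℕ} (hf : Computable f) (hg : Computable g) :
    Computable fun a => f a - g a := Primrec.nat_sub.to_comp.comp hf hg
theorem c_mul {f g : α → ℕ} (hf : Computable f) (hg : Computable g) :
    Computable fun a => f a * g a := Primrec.nat_mul.to_comp.comp hf hg
theorem c_div {f g : α → ℕ} (hf : Computable f) (hg : Computable g) :
    Computable fun a => f a / g a := Primrec.nat_div.to_comp.comp hf hg
theorem c_mod {f g : α → ℕ} (hf : Computable f) (hg : Computable g) :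
    Computable fun a => f a % g a := Primrec.nat_mod.to_comp.comp hf hg
theorem c_pow {f g : α → ℕ} (hf : Computable f) (hg : Computable g) :
    Computable fun a => f a ^ g a := by
  have := Computable.nat_rec (f := g) (g := fun _ : α => 1)
    (h := fun a q => q.2 * f a) hg (Computable.const 1)
    (c_mul (Computable.snd.comp Computable.snd) (hf.comp Computable.fst))
  refine this.of_eq fun a => ?_
  induction g a with
  | zero => rfl
  | succ n ih => rw [pow_succ, ← ih]
theorem c_le {f g : α → ℕ} (hf : Computable f) (hg : Computable g) :
    Computable fun a => decide (f a ≤ g a) :=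
  (Primrec.nat_le.decide).to_comp.comp hf hg
theorem c_lt {f g : α → ℕ} (hf : Computable f) (hg : Computable g) :
    Computable fun a => decide (f a < g a) :=
  (Primrec.nat_lt.decide).to_comp.comp hf hg
theorem c_eq {f g : α → ℕ} (hf : Computable f) (hg : Computable g) :
    Computable fun a => decide (f a = g a) :=
  ((Primrec.eq (α := ℕ)).decide).to_comp.comp hf hg
theorem c_beq {f g : α → Bool} (hf : Computable f) (hg : Computable g) :
    Computable fun a => decide (f a = g a) :=
  ((Primrec.eq (α := Bool)).decide).to_comp.comp hf hg

theorem comp_find {P : α → ℕ → Bool} (hP : Computable fun q : α × ℕ => P q.1 q.2)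
    (h : ∀ a, ∃ n, P a n = true) : Computable fun a => Nat.find (h a) := by
  have h1 : Partrec fun a => Nat.rfind fun n => (Part.some (P a n)) :=
    Partrec.rfind (p := fun a n => Part.some (P a n)) hP.partrec
  refine Partrec.of_eq_tot h1 fun a => ?_

  refine Nat.mem_rfind.2 ⟨?_, ?_⟩
  · simpa using (Nat.find_spec (h a)).symm
  · intro m hm
    have := Nat.find_min (h a) hm
    simpa using this

theorem testBit_eq (m n : ℕ) : m.testBit n = decide (m / 2 ^ n % 2 = 1) := by
  rw [Nat.testBit_eq_decide_div_mod_eq]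

theorem c_testBit {f g : α → ℕ} (hf : Computable f) (hg : Computable g) :
    Computable fun a => (f a).testBit (g a) := by
  refine (c_eq (c_mod (c_div hf (c_pow (Computable.const 2) hg)) (Computable.const 2))
    (Computable.const 1)).of_eq fun a => ?_
  rw [testBit_eq]

theorem c_restr {Y : α → ℕ → Bool} {n : α → ℕ} (hn : Computable n)
    (hY : Computable fun q : α × ℕ => Y q.1 q.2) : Computable fun a => restr (Y a) (n a) := by
  have := Computable.nat_rec (f := n) (g := fun _ : α => ([] : List Bool))
    (h := fun a q => q.2 ++ [Y a q.1]) hn (Computable.const [])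
    (Computable.list_append.comp (Computable.snd.comp Computable.snd)
      (Computable.list_cons.comp (hY.comp (Computable.pair Computable.fst (Computable.fst.comp Computable.snd))) (Computable.const [])))
  refine this.of_eq fun a => ?_
  induction n a with
  | zero => rfl
  | succ k ih => 
    simp only [restr, List.range_succ, List.map_append, List.map_cons, List.map_nil] at ih ⊢
    rw [← ih]

/-- stage approximation of the domain of a code -/
def st (cd : Nat.Partrec.Code) (s x : ℕ) : Bool := (Nat.Partrec.Code.evaln s cd x).isSome

theorem st_mono {cd : Nat.Partrec.Code} {s t x : ℕ} (h : s ≤ t) (hs : st cd s x = true) :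
    st cd t x = true := by
  unfold st at *
  rw [Option.isSome_iff_exists] at *
  obtain ⟨y, hy⟩ := hs
  exact ⟨y, Nat.Partrec.Code.evaln_mono h hy⟩

theorem st_bound {cd : Nat.Partrec.Code} {s x : ℕ} (hs : st cd s x = true) : x < s := by
  unfold st at *
  rw [Option.isSome_iff_exists] at *
  obtain ⟨y, hy⟩ := hs
  exact Nat.Partrec.Code.evaln_bound hy

theorem st_complete {cd : Nat.Partrec.Code} {x : ℕ} :
    (cd.eval x).Dom ↔ ∃ s, st cd s x = true := by
  unfold st
  rw [Part.dom_iff_mem]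
  constructor
  · rintro ⟨y, hy⟩
    obtain ⟨k, hk⟩ := Nat.Partrec.Code.evaln_complete.1 hy
    exact ⟨k, Option.isSome_iff_exists.2 ⟨y, hk⟩⟩
  · rintro ⟨k, hk⟩
    obtain ⟨y, hy⟩ := Option.isSome_iff_exists.1 hk
    exact ⟨y, Nat.Partrec.Code.evaln_complete.2 ⟨k, hy⟩⟩

theorem c_st {cd : α → Nat.Partrec.Code} {s x : α → ℕ} (hc : Computable cd) (hs : Computable s)
    (hx : Computable x) : Computable fun a => st (cd a) (s a) (x a) :=
  Primrec.option_isSome.to_comp.comp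
    (Nat.Partrec.Code.primrec_evaln.to_comp.comp (Computable.pair (Computable.pair hs hc) hx))

end PO


namespace PO

/-- the raw code of a rational -/
def rawQ (q : ℚ) : ℕ := @Encodable.encode ℚ Rat.instEncodable q

theorem rawQ_eq (q : ℚ) : rawQ q = Nat.pair (Equiv.intEquivNat q.num) q.den := rfl

/-- membership in the range of `rawQ` -/
def rngQ (m : ℕ) : Bool :=
  decide (0 < m.unpair.2) && !(bEx (m.unpair.1 + m.unpair.2 + 2) fun d =>
    decide (2 ≤ d) && (decide (((m.unpair.1 + 1) / 2) % d = 0) && decide (m.unpair.2 % d = 0)))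

theorem natAbs_symm (a : ℕ) : (Equiv.intEquivNat.symm a).natAbs = (a + 1) / 2 := by
  obtain ⟨z, rfl⟩ := Equiv.intEquivNat.surjective a
  rw [Equiv.symm_apply_apply]
  cases z with
  | ofNat n =>
    have : Equiv.intEquivNat (Int.ofNat n) = 2 * n := rfl
    rw [this]; simp; omega
  | negSucc n =>
    have : Equiv.intEquivNat (Int.negSucc n) = 2 * n + 1 := rfl
    rw [this]; simp; omega

theorem rngQ_iff (m : ℕ) : rngQ m = true ↔ m ∈ Set.range rawQ := by
  have key : rngQ m = true ↔ 0 < m.unpair.2 ∧ Nat.Coprime ((m.unpair.1 + 1) / 2) m.unpair.2 := by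
    unfold rngQ
    rw [Bool.and_eq_true, decide_eq_true_iff, Bool.not_eq_true', ← Bool.not_eq_true, bEx_iff]
    refine and_congr_right fun hb => ?_
    rw [Nat.coprime_iff_gcd_eq_one]
    constructor
    · intro h
      by_contra hne
      apply h
      set d := Nat.gcd ((m.unpair.1 + 1) / 2) m.unpair.2 with hd
      have hdpos : 0 < d := Nat.gcd_pos_of_pos_right _ hb
      have h1 : d ∣ (m.unpair.1 + 1) / 2 := Nat.gcd_dvd_left _ _
      have h2 : d ∣ m.unpair.2 := Nat.gcd_dvd_right _ _
      have h3 : d ≤ m.unpair.2 := Nat.le_of_dvd hb h2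
      refine ⟨d, by omega, ?_⟩
      simp only [Bool.and_eq_true, decide_eq_true_iff]
      exact ⟨by omega, Nat.mod_eq_zero_of_dvd h1, Nat.mod_eq_zero_of_dvd h2⟩
    · rintro h ⟨d, _, hd⟩
      simp only [Bool.and_eq_true, decide_eq_true_iff] at hd
      have := Nat.dvd_gcd (Nat.dvd_of_mod_eq_zero hd.2.1) (Nat.dvd_of_mod_eq_zero hd.2.2)
      rw [h] at this
      have := Nat.le_of_dvd one_pos this
      omega
  rw [key]
  constructor
  · rintro ⟨h1, h2⟩
    refine ⟨⟨Equiv.intEquivNat.symm m.unpair.1, m.unpair.2, h1.ne', ?_⟩, ?_⟩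
    · rw [natAbs_symm]; exact h2
    · rw [rawQ_eq]
      simp
  · rintro ⟨q, rfl⟩
    rw [rawQ_eq, Nat.unpair_pair]
    refine ⟨q.den_pos, ?_⟩
    rw [← natAbs_symm, Equiv.symm_apply_apply]
    exact q.reduced

theorem c_unpair1 {α} [Primcodable α] {f : α → ℕ} (hf : Computable f) :
    Computable fun a => (f a).unpair.1 := Computable.fst.comp (Computable.unpair.comp hf)
theorem c_unpair2 {α} [Primcodable α] {f : α → ℕ} (hf : Computable f) :
    Computable fun a => (f a).unpair.2 := Computable.snd.comp (Computable.unpair.comp hf)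

theorem c_rngQ : Computable rngQ := by
  unfold rngQ
  have i : Computable (fun q : ℕ × ℕ => q.1) := Computable.fst
  have j : Computable (fun q : ℕ × ℕ => q.2) := Computable.snd
  refine c_and (c_lt (Computable.const 0) (c_unpair2 Computable.id)) (c_not (c_bEx ?_ ?_))
  · exact c_add (c_add (c_unpair1 Computable.id) (c_unpair2 Computable.id)) (Computable.const 2)
  · refine c_and (c_le (Computable.const 2) j) (c_and ?_ ?_)
    · exact c_eq (c_mod (c_div (c_add (c_unpair1 i) (Computable.const 1)) (Computable.const 2)) j)
        (Computable.const 0)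
    · exact c_eq (c_mod (c_unpair2 i) j) (Computable.const 0)

theorem rngQ_ex (x : ℕ) : ∃ m, rngQ (x + m + 1) = true := by
  have h : x + 1 ≤ rawQ ((x + 1 : ℕ) : ℚ) := by
    rw [rawQ_eq]
    refine le_trans ?_ (Nat.left_le_pair _ _)
    rw [Rat.num_natCast]
    show x + 1 ≤ 2 * (x+1)
    omega
  refine ⟨rawQ ((x + 1 : ℕ) : ℚ) - (x + 1), ?_⟩
  rw [rngQ_iff]
  exact ⟨((x + 1 : ℕ) : ℚ), by omega⟩

theorem rngQ_ex0 : ∃ m, rngQ m = true := ⟨_, (rngQ_iff _).2 ⟨0, rfl⟩⟩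

/-- the `n`-th element of the range of `rawQ` -/
def enumQ (n : ℕ) : ℕ :=
  Nat.rec (Nat.find rngQ_ex0) (fun _ x => x + Nat.find (rngQ_ex x) + 1) n

theorem c_enumQ : Computable enumQ := by
  have h1 : Computable fun x : ℕ => Nat.find (rngQ_ex x) :=
    comp_find (P := fun x m => rngQ (x + m + 1))
      (c_rngQ.comp (c_add (c_add Computable.fst Computable.snd) (Computable.const 1))) rngQ_ex
  have := Computable.nat_rec (α := ℕ) (f := fun n => n) (g := fun _ => Nat.find rngQ_ex0)
    (h := fun _ q => q.2 + Nat.find (rngQ_ex q.2) + 1) Computable.id (Computable.const _)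
    (c_add (c_add (Computable.snd.comp Computable.snd)
      (h1.comp (Computable.snd.comp Computable.snd))) (Computable.const 1))
  exact this

theorem enumQ_eq (n : ℕ) : rawQ (Denumerable.ofNat ℚ n) = enumQ n := by
  letI := @Encodable.decidableRangeEncode ℚ Rat.instEncodable
  letI : Infinite (Set.range (@Encodable.encode ℚ Rat.instEncodable)) :=
    Infinite.of_injective _ (Equiv.ofInjective _ Encodable.encode_injective).injective
  have h0 : rawQ (Denumerable.ofNat ℚ n)
      = (Nat.Subtype.ofNat (Set.range (@Encodable.encode ℚ Rat.instEncodable)) n : ℕ) := by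
    have h1 : Denumerable.ofNat ℚ n = (@Encodable.equivRangeEncode ℚ Rat.instEncodable).symm
        (Nat.Subtype.ofNat (Set.range (@Encodable.encode ℚ Rat.instEncodable)) n) := by
      rfl
    rw [h1]
    have := (@Encodable.equivRangeEncode ℚ Rat.instEncodable).apply_symm_apply
      (Nat.Subtype.ofNat (Set.range (@Encodable.encode ℚ Rat.instEncodable)) n)
    exact congrArg Subtype.val this
  rw [h0]
  clear h0
  induction n with
  | zero =>
    apply le_antisymm
    · have hz : enumQ 0 ∈ Set.range (@Encodable.encode ℚ Rat.instEncodable) :=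
        (rngQ_iff _).1 (Nat.find_spec rngQ_ex0)
      have : (⊥ : Set.range (@Encodable.encode ℚ Rat.instEncodable)) ≤ ⟨enumQ 0, hz⟩ := bot_le
      exact this
    · exact Nat.find_min' _ ((rngQ_iff _).2 (Subtype.prop _))
  | succ n ih =>
    have e : enumQ (n+1) = enumQ n + Nat.find (rngQ_ex (enumQ n)) + 1 := rfl
    rw [e]
    show (Nat.Subtype.succ (Nat.Subtype.ofNat _ n) : ℕ) = _
    unfold Nat.Subtype.succ
    simp only
    have : ∀ (k : ℕ) (h : ∃ m, k + m + 1 ∈ Set.range (@Encodable.encode ℚ Rat.instEncodable)),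
        k + Nat.find h + 1 = k + Nat.find (rngQ_ex k) + 1 := by
      intro k h
      congr 2
      apply Nat.find_congr'
      intro m
      exact (rngQ_iff _).symm
    rw [this, ih]

theorem c_rawQ : Computable rawQ := by
  refine (c_enumQ.comp (Computable.encode (α := ℚ))).of_eq fun q => ?_
  rw [← enumQ_eq, Denumerable.ofNat_encode]

/-- Boolean comparison of a nonnegative rational with a power of 1/2. -/
def leQ (q : ℚ) (k : ℕ) : Bool :=
  decide ((rawQ q).unpair.1 / 2 * 2 ^ k ≤ (rawQ q).unpair.2)

theorem c_leQ {α} [Primcodable α] {q : α → ℚ} {k : α → ℕ} (hq : Computable q)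
    (hk : Computable k) : Computable fun a => leQ (q a) (k a) := by
  unfold leQ
  have h := c_rawQ.comp hq
  exact c_le (c_mul (c_div (c_unpair1 h) (Computable.const 2)) (c_pow (Computable.const 2) hk))
    (c_unpair2 h)

theorem leQ_iff {q : ℚ} (hq : 0 ≤ q) (k : ℕ) : leQ q k = true ↔ q ≤ (1 / 2) ^ k := by
  unfold leQ
  rw [decide_eq_true_iff, rawQ_eq, Nat.unpair_pair]
  obtain ⟨n, hn⟩ := Int.eq_ofNat_of_zero_le (Rat.num_nonneg.2 hq)
  have h2 : Equiv.intEquivNat q.num = 2 * n := by rw [hn]; rfl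
  simp only
  rw [h2, Nat.mul_div_cancel_left _ (by norm_num : 0 < 2)]
  have h3 : q = (n : ℚ) / q.den := by
    conv_lhs => rw [← Rat.num_div_den q, hn]
    simp
  have hd : (0 : ℚ) < q.den := by exact_mod_cast q.den_pos
  rw [one_div, inv_pow]
  conv_rhs => rw [h3]
  rw [div_le_iff₀ hd, ← div_eq_inv_mul, le_div_iff₀ (by positivity)]
  exact_mod_cast Iff.rfl

end PO


namespace PO

/-- the sequence of partial values `F` converges monotonically to `p` -/
def Lim {β : Type*} (F : ℕ → Part β) (p : Part β) : Prop :=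
  (∀ k n y, k ≤ n → y ∈ F k → y ∈ F n) ∧ ∀ y, y ∈ p ↔ ∃ n, y ∈ F n

theorem Lim.const {β : Type*} (p : Part β) : Lim (fun _ => p) p :=
  ⟨fun _ _ _ _ h => h, fun _ => ⟨fun h => ⟨0, h⟩, fun ⟨_, h⟩ => h⟩⟩

theorem Lim.bind {β γ : Type*} {F : ℕ → Part β} {p : Part β} {G : β → ℕ → Part γ}
    {q : β → Part γ} (h : Lim F p) (hG : ∀ y, Lim (G y) (q y)) :
    Lim (fun n => (F n).bind fun y => G y n) (p.bind q) := by
  constructor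
  · intro k n y hkn hy
    rw [Part.mem_bind_iff] at *
    obtain ⟨z, h1, h2⟩ := hy
    exact ⟨z, h.1 _ _ _ hkn h1, (hG z).1 _ _ _ hkn h2⟩
  · intro y
    rw [Part.mem_bind_iff]
    constructor
    · rintro ⟨z, h1, h2⟩
      obtain ⟨n1, h1⟩ := (h.2 _).1 h1
      obtain ⟨n2, h2⟩ := ((hG z).2 _).1 h2
      exact ⟨max n1 n2, Part.mem_bind_iff.2 ⟨z, h.1 _ _ _ (le_max_left _ _) h1,
        (hG z).1 _ _ _ (le_max_right _ _) h2⟩⟩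
    · rintro ⟨n, hn⟩
      obtain ⟨z, h1, h2⟩ := Part.mem_bind_iff.1 hn
      exact ⟨z, (h.2 _).2 ⟨n, h1⟩, ((hG z).2 _).2 ⟨n, h2⟩⟩

theorem Lim.map {β γ : Type*} {F : ℕ → Part β} {p : Part β} (f : β → γ)
    (h : Lim F p) : Lim (fun n => (F n).map f) (p.map f) := by
  have := h.bind (G := fun y _ => Part.some (f y)) (q := fun y => Part.some (f y))
    (fun y => Lim.const _)
  simpa [Part.bind_some_eq_map] using this

theorem Lim.rfind {F : ℕ → ℕ → Part Bool} {p : ℕ → Part Bool} (h : ∀ m, Lim (F m) (p m)) :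
    Lim (fun n => Nat.rfind fun m => F m n) (Nat.rfind p) := by
  constructor
  · intro k n y hkn hy
    have hy := Nat.mem_rfind.1 hy
    exact Nat.mem_rfind.2 ⟨(h _).1 _ _ _ hkn hy.1, fun {m} hm => (h _).1 _ _ _ hkn (hy.2 hm)⟩
  · intro y
    constructor
    · intro hy
      have hy := Nat.mem_rfind.1 hy
      have hall : ∀ N ≤ y, ∃ n, ∀ m < N, false ∈ F m n := by
        intro N
        induction N with
        | zero => intro _; exact ⟨0, fun m hm => absurd hm (Nat.not_lt_zero _)⟩
        | succ N ih =>
          intro hN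
          obtain ⟨n1, h1⟩ := ih (by omega)
          obtain ⟨n2, h2⟩ := ((h N).2 _).1 (hy.2 (by omega : N < y))
          refine ⟨max n1 n2, fun m hm => ?_⟩
          by_cases hmN : m = N
          · subst hmN; exact (h _).1 _ _ _ (le_max_right _ _) h2
          · exact (h _).1 _ _ _ (le_max_left _ _) (h1 m (by omega))
      obtain ⟨n1, h1⟩ := hall y le_rfl
      obtain ⟨n2, h2⟩ := ((h y).2 _).1 hy.1
      exact ⟨max n1 n2, Nat.mem_rfind.2 ⟨(h _).1 _ _ _ (le_max_right _ _) h2,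
        fun {m} hm => (h _).1 _ _ _ (le_max_left _ _) (h1 m hm)⟩⟩
    · rintro ⟨n, hn⟩
      have hn := Nat.mem_rfind.1 hn
      exact Nat.mem_rfind.2 ⟨((h _).2 _).2 ⟨n, hn.1⟩, fun {m} hm => ((h _).2 _).2 ⟨n, hn.2 hm⟩⟩

theorem restr_length (Z : ℕ → Bool) (n : ℕ) : (restr Z n).length = n := by simp [restr]

theorem restr_get (Z : ℕ → Bool) (n x : ℕ) :
    (restr Z n)[x]? = if x < n then some (Z x) else none := by
  unfold restr
  rw [List.getElem?_map]
  by_cases h : x < n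
  · simp [h]
  · simp [h]

theorem use_lemma (Z : ℕ → Bool) (f : ℕ →. ℕ) (hf : RecIn (charFn Z) f) :
    ∃ Ψ : List Bool × ℕ →. ℕ, Partrec Ψ ∧ ∀ x, Lim (fun n => Ψ (restr Z n, x)) (f x) := by
  induction hf with
  | oracle =>
    refine ⟨fun q => ((q.1[q.2]?).map fun b => cond b 1 0 : Option ℕ), ?_, ?_⟩
    · refine Computable.ofOption (Computable.option_map ?_ ?_)
      · exact Computable.list_getElem?.comp Computable.fst Computable.snd
      · exact Computable.cond Computable.snd (Computable.const 1) (Computable.const 0)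
    · intro x
      constructor
      · intro k n y hkn hy
        simp only [restr_get, Part.mem_coe, Option.mem_def] at hy ⊢
        by_cases h : x < k
        · rw [if_pos h] at hy
          rw [if_pos (by omega)]; exact hy
        · rw [if_neg h] at hy; simp at hy
      · intro y
        simp only [restr_get, Part.mem_coe, Option.mem_def, charFn, Part.mem_some_iff]
        constructor
        · rintro rfl; exact ⟨x + 1, by simp⟩
        · rintro ⟨n, hn⟩
          by_cases h : x < n
          · rw [if_pos h] at hn; simpa using hn.symm
          · rw [if_neg h] at hn; simp at hn
  | zero => exact ⟨fun _ => Part.some 0, Partrec.const' (Part.some 0), fun x => Lim.const _⟩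
  | succ => exact ⟨fun q => Part.some (q.2 + 1), (Computable.succ.comp Computable.snd).partrec,
      fun x => Lim.const (Part.some (x + 1))⟩
  | left => exact ⟨fun q => Part.some q.2.unpair.1, (c_unpair1 Computable.snd).partrec,
      fun x => Lim.const (Part.some x.unpair.1)⟩
  | right => exact ⟨fun q => Part.some q.2.unpair.2, (c_unpair2 Computable.snd).partrec,
      fun x => Lim.const (Part.some x.unpair.2)⟩
  | @pair f g _ _ ihf ihg =>
    obtain ⟨F, hF, lF⟩ := ihf
    obtain ⟨G, hG, lG⟩ := ihg
    refine ⟨fun q => (F q).bind fun a => (G q).map fun b => Nat.pair a b, ?_, ?_⟩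
    · refine hF.bind ?_
      refine Partrec.map (hG.comp Computable.fst) ?_
      exact Primrec₂.natPair.to_comp.comp (Computable.snd.comp Computable.fst) Computable.snd
    · intro x
      have := (lF x).bind (G := fun a n => (G (restr Z n, x)).map fun b => Nat.pair a b)
        (q := fun a => (g x).map fun b => Nat.pair a b) (fun y => (lG x).map _)
      convert this using 1
      simp [Seq.seq, Part.bind_map]
  | @comp f g _ _ ihf ihg =>
    obtain ⟨F, hF, lF⟩ := ihf
    obtain ⟨G, hG, lG⟩ := ihg
    refine ⟨fun q => (G q).bind fun a => F (q.1, a), ?_, ?_⟩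
    · refine hG.bind ?_
      exact hF.comp (Computable.pair (Computable.fst.comp Computable.fst) Computable.snd)
    · intro x
      exact (lG x).bind (G := fun a n => F (restr Z n, a)) (q := fun a => f a) lF
  | @prec f g _ _ ihf ihg =>
    obtain ⟨F, hF, lF⟩ := ihf
    obtain ⟨G, hG, lG⟩ := ihg
    refine ⟨fun q => q.2.unpair.2.rec (F (q.1, q.2.unpair.1)) fun y IH =>
      IH.bind fun i => G (q.1, Nat.pair q.2.unpair.1 (Nat.pair y i)), ?_, ?_⟩
    · refine Partrec.nat_rec (f := fun q : List Bool × ℕ => q.2.unpair.2)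
        (g := fun q => F (q.1, q.2.unpair.1))
        (h := fun q p => G (q.1, Nat.pair q.2.unpair.1 (Nat.pair p.1 p.2))) ?_ ?_ ?_
      · exact c_unpair2 Computable.snd
      · exact hF.comp (Computable.pair Computable.fst (c_unpair1 Computable.snd))
      · refine hG.comp (Computable.pair (Computable.fst.comp Computable.fst) ?_)
        refine Primrec₂.natPair.to_comp.comp (c_unpair1 (Computable.snd.comp Computable.fst)) ?_
        exact Primrec₂.natPair.to_comp.comp (Computable.fst.comp Computable.snd)
          (Computable.snd.comp Computable.snd)
    · intro x
      simp only [Nat.unpaired]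
      induction x.unpair.2 with
      | zero => exact lF _
      | succ n ih => 
        exact ih.bind (G := fun i m => G (restr Z m, Nat.pair x.unpair.1 (Nat.pair n i)))
          (q := fun i => g (Nat.pair x.unpair.1 (Nat.pair n i))) (fun y => lG _)
  | @rfind f _ ihf =>
    obtain ⟨F, hF, lF⟩ := ihf
    refine ⟨fun q => Nat.rfind fun m => (F (q.1, Nat.pair q.2 m)).map fun m => decide (m = 0),
      ?_, ?_⟩
    · refine Partrec.rfind (p := fun (q : List Bool × ℕ) m =>
        (F (q.1, Nat.pair q.2 m)).map fun m => decide (m = 0)) ?_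
      refine Partrec.map (hF.comp (Computable.pair (Computable.fst.comp Computable.fst) ?_)) ?_
      · exact Primrec₂.natPair.to_comp.comp (Computable.snd.comp Computable.fst) Computable.snd
      · exact c_eq Computable.snd (Computable.const 0)
    · intro x
      exact Lim.rfind (F := fun m n => (F (restr Z n, Nat.pair x m)).map fun m => decide (m = 0))
        (p := fun m => (f (Nat.pair x m)).map fun m => decide (m = 0)) (fun m => (lF _).map _)

theorem code_of_turing {A Z : ℕ → Bool} (h : TuringLE A Z) :
    ∃ w : Nat.Partrec.Code, ∀ x, A x = false ↔
      ∃ n, (w.eval (Encodable.encode (restr Z n, x))).Dom := by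
  obtain ⟨Ψ, hΨ, hl⟩ := use_lemma Z _ h
  have h1 : Partrec fun q : List Bool × ℕ => (Ψ q).bind fun y =>
      ((if y = 0 then some 0 else none : Option ℕ) : Part ℕ) := by
    refine hΨ.bind (Computable.ofOption ?_)
    have : Computable fun y : ℕ => (if y = 0 then some 0 else none : Option ℕ) := by
      refine (Computable.cond (c_eq Computable.id (Computable.const 0)) (Computable.const (some 0))
        (Computable.const (none : Option ℕ))).of_eq fun y => ?_
      by_cases hy : y = 0 <;> simp [hy]
    exact this.comp Computable.snd
  obtain ⟨w, hw⟩ := Nat.Partrec.Code.exists_code.1 h1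
  refine ⟨w, fun x => ?_⟩
  have key : ∀ q : List Bool × ℕ, (w.eval (Encodable.encode q)).Dom ↔ 0 ∈ Ψ q := by
    intro q
    rw [hw]
    simp only [Encodable.encodek, Part.coe_some, Part.bind_some, Part.map_Dom]
    rw [Part.dom_iff_mem]
    constructor
    · rintro ⟨y, hy⟩
      obtain ⟨z, h1, h2⟩ := Part.mem_bind_iff.1 hy
      by_cases hz : z = 0
      · exact hz ▸ h1
      · simp [hz] at h2
    · intro h0
      exact ⟨0, Part.mem_bind_iff.2 ⟨0, h0, by simp⟩⟩
  simp only [key]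
  rw [← (hl x).2]
  unfold charFn
  rw [Part.mem_some_iff]
  cases A x <;> simp

theorem code_of_ce {A : ℕ → Bool} (h : CE A) :
    ∃ a : Nat.Partrec.Code, ∀ x, A x = true ↔ (a.eval x).Dom := by
  obtain ⟨f, hf, hA⟩ := h
  obtain ⟨a, rfl⟩ := Nat.Partrec.Code.exists_code.1 hf
  exact ⟨a, hA⟩

theorem code_of_pi01 {f : ℕ → Option (List Bool)} (hf : Computable f) :
    ∃ p : Nat.Partrec.Code, ∀ σ, (∃ i, f i = some σ) ↔ (p.eval (Encodable.encode σ)).Dom := by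
  have h1 : Partrec fun σ : List Bool => Nat.rfind fun i => Part.some (decide (f i = some σ)) := by
    refine Partrec.rfind (p := fun (σ : List Bool) i => Part.some (decide (f i = some σ))) ?_
    refine Computable.partrec ?_
    exact ((Primrec.eq (α := Option (List Bool))).decide).to_comp.comp (hf.comp Computable.snd)
      (Primrec.option_some.to_comp.comp Computable.fst)
  obtain ⟨p, hp⟩ := Nat.Partrec.Code.exists_code.1 h1
  refine ⟨p, fun σ => ?_⟩
  rw [hp]
  simp only [Encodable.encodek, Part.coe_some, Part.bind_some, Part.map_Dom]
  constructor
  · rintro ⟨i, hi⟩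
    exact Nat.rfind_dom.2 ⟨i, by simp [hi], fun _ => trivial⟩
  · intro hd
    obtain ⟨i, hi, _⟩ := Nat.rfind_dom.1 hd
    exact ⟨i, by simpa using hi⟩

end PO


namespace PO
open Nat.Partrec (Code)

/-- triangular numbers -/
def tri (j : ℕ) : ℕ := Nat.rec 0 (fun k r => r + (k + 1)) j

theorem tri_succ (j : ℕ) : tri (j + 1) = tri j + (j + 1) := rfl

theorem tri_mono : Monotone tri := monotone_nat_of_le_succ fun j => by rw [tri_succ]; omega

theorem le_tri (j : ℕ) : j ≤ tri j := by
  induction j with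
  | zero => simp
  | succ j ih => rw [tri_succ]; omega

theorem c_tri : Computable tri :=
  Computable.nat_rec (α := ℕ) (f := fun n => n) (g := fun _ => 0)
    (h := fun _ q => q.2 + (q.1 + 1)) Computable.id (Computable.const _)
    (c_add (Computable.snd.comp Computable.snd)
      (c_add (Computable.fst.comp Computable.snd) (Computable.const 1)))

/-- decoding of node numbers into pairs `(j,i)` with `i ≤ j` -/
def node (t : ℕ) : ℕ × ℕ :=
  Nat.rec (0, 0) (fun _ q => cond (decide (q.2 < q.1)) (q.1, q.2 + 1) (q.1 + 1, 0)) t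

theorem c_node : Computable node := by
  have s2 : Computable fun a : ℕ × (ℕ × (ℕ × ℕ)) => a.2.2 := Computable.snd.comp Computable.snd
  refine Computable.nat_rec (α := ℕ) (f := fun n => n) (g := fun _ => (0,0))
    (h := fun _ q => cond (decide (q.2.2 < q.2.1)) (q.2.1, q.2.2 + 1) (q.2.1 + 1, 0))
    Computable.id (Computable.const _) ?_
  refine Computable.cond (c_lt (Computable.snd.comp s2) (Computable.fst.comp s2)) ?_ ?_
  · exact Computable.pair (Computable.fst.comp s2) (c_add (Computable.snd.comp s2) (Computable.const 1))
  · exact Computable.pair (c_add (Computable.fst.comp s2) (Computable.const 1)) (Computable.const 0)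

/-- number of the node `(j,i)` -/
def tn (j i : ℕ) : ℕ := tri j + i

theorem node_spec (t : ℕ) : (node t).2 ≤ (node t).1 ∧ tn (node t).1 (node t).2 = t := by
  induction t with
  | zero => exact ⟨le_rfl, rfl⟩
  | succ t ih =>
    have e : node (t+1) = cond (decide ((node t).2 < (node t).1)) ((node t).1, (node t).2 + 1)
      ((node t).1 + 1, 0) := rfl
    rw [e]
    unfold tn at *
    by_cases h : (node t).2 < (node t).1
    · simp only [h, decide_true, cond_true]; omega
    · simp only [h, decide_false, cond_false, tri_succ]; omega

theorem tn_lt {j i j' i' : ℕ} (hi : i ≤ j) (h : tn j i < tn j' i') (hi' : i' ≤ j') :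
    j < j' ∨ (j = j' ∧ i < i') := by
  unfold tn at h
  rcases lt_trichotomy j j' with h1 | h1 | h1
  · exact Or.inl h1
  · subst h1; right; exact ⟨rfl, by omega⟩
  · exfalso
    have := tri_mono (show j' + 1 ≤ j from h1)
    rw [tri_succ] at this
    omega

theorem tn_inj {j i j' i' : ℕ} (hi : i ≤ j) (hi' : i' ≤ j') (h : tn j i = tn j' i') :
    j = j' ∧ i = i' := by
  have h0 := h
  unfold tn at h
  have : j = j' := by
    rcases lt_trichotomy j j' with h1 | h1 | h1
    · have := tri_mono (show j + 1 ≤ j' from h1)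
      rw [tri_succ] at this
      omega
    · exact h1
    · have := tri_mono (show j' + 1 ≤ j from h1)
      rw [tri_succ] at this
      omega
  subst this
  exact ⟨rfl, by omega⟩

theorem node_tn {j i : ℕ} (hi : i ≤ j) : node (tn j i) = (j, i) := by
  obtain ⟨h1, h2⟩ := node_spec (tn j i)
  obtain ⟨h3, h4⟩ := tn_inj h1 hi h2
  exact Prod.ext h3 h4

theorem tn_lt_of {j i j' i' : ℕ} (hi : i ≤ j) (h : j < j' ∨ (j = j' ∧ i < i')) :
    tn j i < tn j' i' := by
  unfold tn
  rcases h with h | ⟨rfl, h⟩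
  · have := tri_mono (show j + 1 ≤ j' from h)
    rw [tri_succ] at this
    omega
  · omega

/-- binary number from a bit sequence -/
def bs (N : ℕ) (Y : ℕ → Bool) : ℕ := Nat.rec 0 (fun k r => r + cond (Y k) (2 ^ k) 0) N

theorem bs_succ (N : ℕ) (Y : ℕ → Bool) : bs (N + 1) Y = bs N Y + cond (Y N) (2 ^ N) 0 := rfl

theorem bs_lt (N : ℕ) (Y : ℕ → Bool) : bs N Y < 2 ^ N := by
  induction N with
  | zero => simp [bs]
  | succ N ih =>
    rw [bs_succ, pow_succ]
    cases Y N <;> simp <;> omega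

theorem bs_testBit {N : ℕ} {Y : ℕ → Bool} {u : ℕ} (hu : u < N) : (bs N Y).testBit u = Y u := by
  induction N with
  | zero => omega
  | succ N ih =>
    rw [bs_succ]
    by_cases h : u = N
    · subst h
      have h0 : (bs u Y).testBit u = false := Nat.testBit_lt_two_pow (bs_lt u Y)
      cases hY : Y u
      · simp [h0]
      · simp only [cond_true]
        rw [Nat.add_comm, Nat.testBit_two_pow_add_eq, h0]; rfl
    · have hu' : u < N := by omega
      cases hY : Y N
      · simpa using ih hu'
      · simp only [cond_true]
        rw [Nat.add_comm, Nat.testBit_two_pow_add_gt hu', ih hu']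

/-- codes of the requirement `r` -/
def rqA (r : ℕ) : Code := Denumerable.ofNat Code r.unpair.1
/-- codes of the requirement `r` -/
def rqW (r : ℕ) : Code := Denumerable.ofNat Code r.unpair.2

theorem rq_surj (a w : Code) : ∃ r, rqA r = a ∧ rqW r = w :=
  ⟨Nat.pair (Encodable.encode a) (Encodable.encode w), by simp [rqA], by simp [rqW]⟩

/-- the oracle enumeration -/
def phi (w : Code) (s : ℕ) (Y : ℕ → Bool) (x : ℕ) : Bool :=
  bEx (s + 1) fun n => st w s (Encodable.encode (restr Y n, x))

/-- the test at node `t` with bound `g` -/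
def tst (t g s : ℕ) (Y : ℕ → Bool) : Bool :=
  cond (decide ((node t).2 = 0)) (!(Y (node t).1))
    (bEx g fun x => !(st (rqA ((node t).2 - 1)) s x) && !(phi (rqW ((node t).2 - 1)) s Y x))

/-- approximation to the class -/
def base (p : Code) (s : ℕ) (Y : ℕ → Bool) : Bool :=
  !(bEx (s + 1) fun n => st p s (Encodable.encode (restr Y n)))

/-- weights -/
def wt (k : ℕ) : ℕ := k + 2 ^ tri (k + 2)

/-- movable markers -/
def SS (F : ℕ → ℕ → ℕ) (s k : ℕ) : ℕ := Nat.rec 0 (fun k r => r + F s (wt k + r)) k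

/-- index of the marker of a node -/
def eidx (t : ℕ) : ℕ := tri (node t).1 + ((node t).1 - (node t).2)

/-- the marker of a node -/
def gg (F : ℕ → ℕ → ℕ) (s t : ℕ) : ℕ := SS F s (eidx t + 1)

/-- tests satisfied as prescribed by the outcomes coded in `O` -/
def alvN (F : ℕ → ℕ → ℕ) (p : Code) (O s t : ℕ) (Y : ℕ → Bool) : Bool :=
  base p s Y && bAll t fun u => !(O.testBit u) || tst u (gg F s u) s Y

/-- next outcome -/
def oN (F : ℕ → ℕ → ℕ) (p : Code) (O s t : ℕ) : Bool :=
  bEx (2 ^ (s + t + 1)) fun m => alvN F p O s t m.testBit && tst t (gg F s t) s m.testBit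

/-- coded outcomes -/
def OO (F : ℕ → ℕ → ℕ) (p : Code) (s t : ℕ) : ℕ :=
  Nat.rec 0 (fun t O => O + cond (oN F p O s t) (2 ^ t) 0) t

/-- outcomes -/
def oo (F : ℕ → ℕ → ℕ) (p : Code) (s t : ℕ) : Bool := oN F p (OO F p s t) s t

theorem OO_eq (F : ℕ → ℕ → ℕ) (p : Code) (s t : ℕ) : OO F p s t = bs t (oo F p s) := by
  induction t with
  | zero => rfl
  | succ t ih =>
    rw [bs_succ, ← ih]; rfl

/-! Computability -/

section comp
variable {α : Type*} [Primcodable α]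

theorem c_rqA {r : α → ℕ} (hr : Computable r) : Computable fun a => rqA (r a) :=
  (Computable.ofNat Code).comp (c_unpair1 hr)
theorem c_rqW {r : α → ℕ} (hr : Computable r) : Computable fun a => rqW (r a) :=
  (Computable.ofNat Code).comp (c_unpair2 hr)

theorem c_enc {β : Type*} [Primcodable β] {f : α → β} (h : Computable f) :
    Computable fun a => Encodable.encode (f a) := Computable.encode.comp h

theorem c_phi {w : α → Code} {s x : α → ℕ} {Y : α → ℕ → Bool} (hw : Computable w)
    (hs : Computable s) (hx : Computable x) (hY : Computable fun q : α × ℕ => Y q.1 q.2) :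
    Computable fun a => phi (w a) (s a) (Y a) (x a) := by
  unfold phi
  refine c_bEx (c_add hs (Computable.const 1)) (c_st (hw.comp Computable.fst)
    (hs.comp Computable.fst) (c_enc (Computable.pair ?_ (hx.comp Computable.fst))))
  refine c_restr (Y := fun q : α × ℕ => Y q.1) Computable.snd ?_
  exact hY.comp (Computable.pair (Computable.fst.comp Computable.fst) Computable.snd)

theorem c_base {p : Code} {s : α → ℕ} {Y : α → ℕ → Bool}
    (hs : Computable s) (hY : Computable fun q : α × ℕ => Y q.1 q.2) :
    Computable fun a => base p (s a) (Y a) := by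
  unfold base
  refine c_not (c_bEx (c_add hs (Computable.const 1)) (c_st (Computable.const p)
    (hs.comp Computable.fst) (c_enc ?_)))
  refine c_restr (Y := fun q : α × ℕ => Y q.1) Computable.snd ?_
  exact hY.comp (Computable.pair (Computable.fst.comp Computable.fst) Computable.snd)

theorem c_tst {t g s : α → ℕ} {Y : α → ℕ → Bool} (ht : Computable t) (hg : Computable g)
    (hs : Computable s) (hY : Computable fun q : α × ℕ => Y q.1 q.2) :
    Computable fun a => tst (t a) (g a) (s a) (Y a) := by
  unfold tst
  have n1 : Computable fun a => (node (t a)).1 := Computable.fst.comp (c_node.comp ht)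
  have n2 : Computable fun a => (node (t a)).2 := Computable.snd.comp (c_node.comp ht)
  have r1 : Computable fun a => (node (t a)).2 - 1 := c_sub n2 (Computable.const 1)
  refine Computable.cond (c_eq n2 (Computable.const 0)) ?_ ?_
  · exact c_not (hY.comp (Computable.pair Computable.id n1))
  · refine c_bEx hg (c_and (c_not ?_) (c_not ?_))
    · exact c_st (c_rqA (r1.comp Computable.fst)) (hs.comp Computable.fst) Computable.snd
    · refine c_phi (Y := fun q : α × ℕ => Y q.1) (c_rqW (r1.comp Computable.fst))
        (hs.comp Computable.fst) Computable.snd ?_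
      exact hY.comp (Computable.pair (Computable.fst.comp Computable.fst) Computable.snd)

theorem c_wt : Computable wt :=
  c_add Computable.id (c_pow (Computable.const 2) (c_tri.comp (c_add Computable.id (Computable.const 2))))

theorem c_SS {F : ℕ → ℕ → ℕ} (hF : Computable₂ F) {s k : α → ℕ} (hs : Computable s)
    (hk : Computable k) : Computable fun a => SS F (s a) (k a) := by
  refine Computable.nat_rec (f := k) (g := fun _ => 0)
    (h := fun a q => q.2 + F (s a) (wt q.1 + q.2)) hk (Computable.const _) ?_
  have s2 : Computable fun a : α × (ℕ × ℕ) => a.2.2 := Computable.snd.comp Computable.snd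
  refine c_add s2 (hF.comp (hs.comp Computable.fst) (c_add (c_wt.comp ?_) s2))
  exact Computable.fst.comp Computable.snd

theorem c_eidx : Computable eidx := by
  have n1 : Computable fun a => (node a).1 := Computable.fst.comp c_node
  have n2 : Computable fun a => (node a).2 := Computable.snd.comp c_node
  exact c_add (c_tri.comp n1) (c_sub n1 n2)

theorem c_gg {F : ℕ → ℕ → ℕ} (hF : Computable₂ F) {s t : α → ℕ} (hs : Computable s)
    (ht : Computable t) : Computable fun a => gg F (s a) (t a) :=
  c_SS hF hs (c_add (c_eidx.comp ht) (Computable.const 1))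

theorem c_alvN {F : ℕ → ℕ → ℕ} (hF : Computable₂ F) {p : Code} {O s t : α → ℕ}
    {Y : α → ℕ → Bool} (hO : Computable O) (hs : Computable s)
    (ht : Computable t) (hY : Computable fun q : α × ℕ => Y q.1 q.2) :
    Computable fun a => alvN F p (O a) (s a) (t a) (Y a) := by
  unfold alvN
  refine c_and (c_base hs hY) (c_bAll ht (c_or (c_not ?_) ?_))
  · exact c_testBit (hO.comp Computable.fst) Computable.snd
  · refine c_tst (Y := fun q : α × ℕ => Y q.1) Computable.snd
      (c_gg hF (hs.comp Computable.fst) Computable.snd) (hs.comp Computable.fst) ?_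
    exact hY.comp (Computable.pair (Computable.fst.comp Computable.fst) Computable.snd)

theorem c_oN {F : ℕ → ℕ → ℕ} (hF : Computable₂ F) {p : Code} {O s t : α → ℕ}
    (hO : Computable O) (hs : Computable s) (ht : Computable t) :
    Computable fun a => oN F p (O a) (s a) (t a) := by
  unfold oN
  have f1 : Computable (Prod.fst : α × ℕ → α) := Computable.fst
  refine c_bEx (c_pow (Computable.const 2) (c_add (c_add hs ht) (Computable.const 1)))
    (c_and ?_ ?_)
  · refine c_alvN (Y := fun q : α × ℕ => q.2.testBit) hF (hO.comp f1) (hs.comp f1) (ht.comp f1) ?_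
    exact c_testBit (Computable.snd.comp Computable.fst) Computable.snd
  · refine c_tst (Y := fun q : α × ℕ => q.2.testBit) (ht.comp f1) (c_gg hF (hs.comp f1) (ht.comp f1))
      (hs.comp f1) ?_
    exact c_testBit (Computable.snd.comp Computable.fst) Computable.snd

theorem c_OO {F : ℕ → ℕ → ℕ} (hF : Computable₂ F) {p : Code} {s t : α → ℕ}
    (hs : Computable s) (ht : Computable t) :
    Computable fun a => OO F p (s a) (t a) := by
  refine Computable.nat_rec (f := t) (g := fun _ => 0)
    (h := fun a q => q.2 + cond (oN F p q.2 (s a) q.1) (2 ^ q.1) 0) ht (Computable.const _) ?_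
  have s1 : Computable fun a : α × (ℕ × ℕ) => a.2.1 := Computable.fst.comp Computable.snd
  have s2 : Computable fun a : α × (ℕ × ℕ) => a.2.2 := Computable.snd.comp Computable.snd
  exact c_add s2 (Computable.cond (c_oN hF s2 (hs.comp Computable.fst) s1)
    (c_pow (Computable.const 2) s1) (Computable.const 0))

theorem c_oo {F : ℕ → ℕ → ℕ} (hF : Computable₂ F) {p : Code} {s t : α → ℕ}
    (hs : Computable s) (ht : Computable t) :
    Computable fun a => oo F p (s a) (t a) := c_oN hF (c_OO hF hs ht) hs ht

end comp

end PO


namespace PO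
open Nat.Partrec (Code)

theorem restr_congr {Y Y' : ℕ → Bool} {n : ℕ} (h : ∀ k < n, Y k = Y' k) : restr Y n = restr Y' n := by
  unfold restr
  apply List.map_congr_left
  intro k hk
  exact h k (List.mem_range.1 hk)

theorem bEx_congr {n : ℕ} {p q : ℕ → Bool} (h : ∀ k < n, p k = q k) : bEx n p = bEx n q := by
  rw [Bool.eq_iff_iff, bEx_iff, bEx_iff]
  constructor
  · rintro ⟨k, hk, hp⟩; exact ⟨k, hk, h k hk ▸ hp⟩
  · rintro ⟨k, hk, hp⟩; exact ⟨k, hk, (h k hk).symm ▸ hp⟩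

theorem phi_iff {w : Code} {s : ℕ} {Y : ℕ → Bool} {x : ℕ} :
    phi w s Y x = true ↔ ∃ n ≤ s, st w s (Encodable.encode (restr Y n, x)) = true := by
  unfold phi
  rw [bEx_iff]
  simp only [Nat.lt_succ_iff]

theorem phi_local {w : Code} {s : ℕ} {Y Y' : ℕ → Bool} {x : ℕ} (h : ∀ k < s, Y k = Y' k) :
    phi w s Y x = phi w s Y' x := by
  unfold phi
  apply bEx_congr
  intro n hn
  rw [restr_congr fun k hk => h k (by omega)]

theorem phi_mono {w : Code} {s s' : ℕ} {Y : ℕ → Bool} {x : ℕ} (hs : s ≤ s')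
    (h : phi w s Y x = true) : phi w s' Y x = true := by
  rw [phi_iff] at *
  obtain ⟨n, hn, h⟩ := h
  exact ⟨n, hn.trans hs, st_mono hs h⟩

theorem base_iff {p : Code} {s : ℕ} {Y : ℕ → Bool} :
    base p s Y = true ↔ ∀ n ≤ s, st p s (Encodable.encode (restr Y n)) = false := by
  unfold base
  rw [Bool.not_eq_true', ← Bool.not_eq_true, bEx_iff]
  simp [Nat.lt_succ_iff]

theorem base_local {p : Code} {s : ℕ} {Y Y' : ℕ → Bool} (h : ∀ k < s, Y k = Y' k) :
    base p s Y = base p s Y' := by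
  unfold base
  rw [bEx_congr]
  intro n hn
  rw [restr_congr fun k hk => h k (by omega)]

theorem base_anti {p : Code} {s s' : ℕ} {Y : ℕ → Bool} (hs : s ≤ s') (h : base p s' Y = true) :
    base p s Y = true := by
  rw [base_iff] at *
  intro n hn
  by_contra hc
  rw [Bool.not_eq_false] at hc
  have := h n (hn.trans hs)
  rw [st_mono hs hc] at this
  exact absurd this (by decide)

theorem node1_le (t : ℕ) : (node t).1 ≤ t := by
  have := (node_spec t).2
  unfold tn at this
  have := le_tri (node t).1
  omega

theorem tst_zero {t g s : ℕ} {Y : ℕ → Bool} (h : (node t).2 = 0) :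
    tst t g s Y = !(Y (node t).1) := by
  unfold tst; simp [h]

theorem tst_pos {t g s : ℕ} {Y : ℕ → Bool} (h : (node t).2 ≠ 0) :
    tst t g s Y = true ↔ ∃ x < g, st (rqA ((node t).2 - 1)) s x = false ∧
      phi (rqW ((node t).2 - 1)) s Y x = false := by
  unfold tst
  simp [h, bEx_iff]

theorem tst_local {t g s : ℕ} {Y Y' : ℕ → Bool} (h : ∀ k < s + t + 1, Y k = Y' k) :
    tst t g s Y = tst t g s Y' := by
  by_cases h0 : (node t).2 = 0
  · rw [tst_zero h0, tst_zero h0, h _ (by have := node1_le t; omega)]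
  · rw [Bool.eq_iff_iff, tst_pos h0, tst_pos h0]
    simp only [phi_local (s := s) (Y := Y) (Y' := Y') fun k hk => h k (by omega)]

theorem tst_mono {t g g' s s' : ℕ} {Y : ℕ → Bool} (hg : g ≤ g') (hs : s ≤ s')
    (h : tst t g s' Y = true) : tst t g' s Y = true := by
  by_cases h0 : (node t).2 = 0
  · rw [tst_zero h0] at *; exact h
  · rw [tst_pos h0] at *
    obtain ⟨x, hx, h1, h2⟩ := h
    refine ⟨x, by omega, ?_, ?_⟩
    · by_contra hc
      rw [Bool.not_eq_false] at hc
      rw [st_mono hs hc] at h1; exact absurd h1 (by decide)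
    · by_contra hc
      rw [Bool.not_eq_false] at hc
      rw [phi_mono hs hc] at h2; exact absurd h2 (by decide)

theorem tst_same {j j' i g s : ℕ} {Y : ℕ → Bool} (hi : 1 ≤ i) (h : i ≤ j) (h' : i ≤ j') :
    tst (tn j i) g s Y = tst (tn j' i) g s Y := by
  have e := node_tn h
  have e' := node_tn h'
  rw [Bool.eq_iff_iff, tst_pos (by rw [e]; simp; omega), tst_pos (by rw [e']; simp; omega), e, e']

/-- Hypotheses on the markers and the class. -/
structure Good (F : ℕ → ℕ → ℕ) (p : Code) : Prop where
  Fm : ∀ s s' q q', s ≤ s' → q ≤ q' → F s q ≤ F s' q'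
  Fstab : ∀ q, ∃ s0, ∀ s ≥ s0, F s q = F s0 q
  ne : ∃ Z0 : ℕ → Bool, ∀ n s, st p s (Encodable.encode (restr Z0 n)) = false

section sem
variable {F : ℕ → ℕ → ℕ} {p : Code}

theorem SS_succ (s k : ℕ) : SS F s (k + 1) = SS F s k + F s (wt k + SS F s k) := rfl

theorem SS_mono_k (s : ℕ) : Monotone (SS F s) :=
  monotone_nat_of_le_succ fun k => by rw [SS_succ]; omega

theorem SS_mono_s (H : Good F p) {s s' : ℕ} (h : s ≤ s') (k : ℕ) : SS F s k ≤ SS F s' k := by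
  induction k with
  | zero => exact le_rfl
  | succ k ih =>
    rw [SS_succ, SS_succ]
    have := H.Fm s s' (wt k + SS F s k) (wt k + SS F s' k) h (by omega)
    omega

theorem SS_agree (H : Good F p) {s s' : ℕ} (h : s ≤ s') (k : ℕ) (e : SS F s k = SS F s' k) :
    ∀ k' ≤ k, SS F s k' = SS F s' k' := by
  induction k with
  | zero => intro k' hk'; have : k' = 0 := by omega
            subst this; rfl
  | succ k ih =>
    have h1 := SS_mono_s H h k
    have h2 := H.Fm s s' (wt k + SS F s k) (wt k + SS F s' k) h (by omega)
    rw [SS_succ, SS_succ] at e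
    intro k' hk'
    by_cases hk : k' = k + 1
    · subst hk; rw [SS_succ, SS_succ]; exact e
    · exact ih (by omega) k' (by omega)

theorem SS_stab (H : Good F p) (k : ℕ) : ∃ s0, ∀ s ≥ s0, SS F s k = SS F s0 k := by
  induction k with
  | zero => exact ⟨0, fun _ _ => rfl⟩
  | succ k ih =>
    obtain ⟨s0, h0⟩ := ih
    obtain ⟨s1, h1⟩ := H.Fstab (wt k + SS F s0 k)
    refine ⟨max s0 s1, fun s hs => ?_⟩
    rw [SS_succ, SS_succ, h0 s (le_of_max_le_left hs), h0 _ (le_max_left _ _),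
      h1 s (le_of_max_le_right hs), h1 _ (le_max_right _ _)]

theorem gg_tn {j i : ℕ} (h : i ≤ j) (s : ℕ) : gg F s (tn j i) = SS F s (tri j + (j - i) + 1) := by
  unfold gg eidx
  rw [node_tn h]

theorem gg_mono_s (H : Good F p) {s s' : ℕ} (h : s ≤ s') (t : ℕ) : gg F s t ≤ gg F s' t :=
  SS_mono_s H h _

theorem gg_mono_j {j j' i : ℕ} (h : i ≤ j) (hj : j ≤ j') (s : ℕ) :
    gg F s (tn j i) ≤ gg F s (tn j' i) := by
  rw [gg_tn h, gg_tn (h.trans hj)]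
  apply SS_mono_k
  have := tri_mono hj
  omega

/-- `Y` is alive at stage `s` at node `t` -/
def Alv (F : ℕ → ℕ → ℕ) (p : Code) (s t : ℕ) (Y : ℕ → Bool) : Prop :=
  base p s Y = true ∧ ∀ u < t, oo F p s u = true → tst u (gg F s u) s Y = true

theorem alvN_iff {s t : ℕ} {Y : ℕ → Bool} :
    alvN F p (OO F p s t) s t Y = true ↔ Alv F p s t Y := by
  unfold alvN Alv
  rw [Bool.and_eq_true, bAll_iff]
  refine and_congr_right fun _ => forall_congr' fun u => forall_congr' fun hu => ?_
  rw [OO_eq, bs_testBit hu]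
  cases oo F p s u <;> simp

theorem Alv.mono {s t t' : ℕ} {Y : ℕ → Bool} (h : Alv F p s t' Y) (ht : t ≤ t') : Alv F p s t Y :=
  ⟨h.1, fun u hu => h.2 u (by omega)⟩

theorem alv_local {s t : ℕ} {Y Y' : ℕ → Bool} (h : ∀ k < s + t + 1, Y k = Y' k)
    (hY : Alv F p s t Y) : Alv F p s t Y' := by
  constructor
  · rw [← base_local (Y := Y) fun k hk => h k (by omega)]; exact hY.1
  · intro u hu ho
    rw [← tst_local (Y := Y) fun k hk => h k (by omega)]; exact hY.2 u hu ho

theorem oo_iff {s t : ℕ} :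
    oo F p s t = true ↔ ∃ Y, Alv F p s t Y ∧ tst t (gg F s t) s Y = true := by
  unfold oo oN
  rw [bEx_iff]
  constructor
  · rintro ⟨m, hm, h⟩
    rw [Bool.and_eq_true, alvN_iff] at h
    exact ⟨_, h⟩
  · rintro ⟨Y, h1, h2⟩
    refine ⟨bs (s + t + 1) Y, bs_lt _ _, ?_⟩
    have e : ∀ k < s + t + 1, Y k = (bs (s + t + 1) Y).testBit k := fun k hk => (bs_testBit hk).symm
    rw [Bool.and_eq_true, alvN_iff]
    exact ⟨alv_local e h1, by rw [← tst_local e]; exact h2⟩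

theorem alv_ex (H : Good F p) (s t : ℕ) : ∃ Y, Alv F p s t Y := by
  induction t with
  | zero =>
    obtain ⟨Z0, h⟩ := H.ne
    exact ⟨Z0, base_iff.2 fun n _ => h n s, fun u hu => absurd hu (Nat.not_lt_zero _)⟩
  | succ t ih =>
    by_cases h : oo F p s t = true
    · obtain ⟨Y, h1, h2⟩ := oo_iff.1 h
      refine ⟨Y, h1.1, fun u hu ho => ?_⟩
      by_cases hut : u = t
      · subst hut; exact h2
      · exact h1.2 u (by omega) ho
    · obtain ⟨Y, h1⟩ := ih
      refine ⟨Y, h1.1, fun u hu ho => ?_⟩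
      by_cases hut : u = t
      · subst hut; exact absurd ho h
      · exact h1.2 u (by omega) ho

theorem oo_mono_j (H : Good F p) {s j i : ℕ} (hi : 1 ≤ i) (h : i ≤ j)
    (ho : oo F p s (tn j i) = true) : oo F p s (tn (j + 1) i) = true := by
  obtain ⟨Y, hY⟩ := alv_ex H s (tn (j + 1) i)
  refine oo_iff.2 ⟨Y, hY, ?_⟩
  have := hY.2 (tn j i) (tn_lt_of h (Or.inl (by omega))) ho
  rw [tst_same hi (show i ≤ j + 1 by omega) h]
  exact tst_mono (gg_mono_j h (by omega) s) le_rfl this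

/-- outcomes and markers of nodes below `t` are stable from `s0` on -/
def Stab (F : ℕ → ℕ → ℕ) (p : Code) (s0 t : ℕ) : Prop :=
  ∀ s ≥ s0, ∀ u < t, oo F p s u = oo F p s0 u ∧ gg F s u = gg F s0 u

theorem Stab.mono {s0 s1 t t' : ℕ} (h : Stab F p s0 t) (hs : s0 ≤ s1) (ht : t' ≤ t) :
    Stab F p s1 t' := by
  intro s hs' u hu
  have h1 := h s (le_trans hs hs') u (by omega)
  have h2 := h s1 hs u (by omega)
  rw [h1.1, h1.2, h2.1, h2.2]; exact ⟨rfl, rfl⟩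

theorem alv_anti {s0 t s s' : ℕ} {Y : ℕ → Bool} (h : Stab F p s0 t) (h0 : s0 ≤ s) (hs : s ≤ s')
    (hY : Alv F p s' t Y) : Alv F p s t Y := by
  refine ⟨base_anti hs hY.1, fun u hu ho => ?_⟩
  have h1 := h s h0 u hu
  have h2 := h s' (h0.trans hs) u hu
  have := hY.2 u hu (by rw [h2.1, ← h1.1]; exact ho)
  exact tst_mono (by rw [h1.2, h2.2]) hs this

theorem stab_ex (H : Good F p) (t : ℕ) : ∃ s0, Stab F p s0 t := by
  induction t with
  | zero => exact ⟨0, fun s _ u hu => absurd hu (Nat.not_lt_zero _)⟩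
  | succ t ih =>
    obtain ⟨s0, h0⟩ := ih
    obtain ⟨s1, h1⟩ := SS_stab H (eidx t + 1)
    set s2 := max s0 s1 with hs2
    have hst : Stab F p s2 t := h0.mono (le_max_left _ _) le_rfl
    have hg : ∀ s ≥ s2, gg F s t = gg F s1 t := fun s hs => h1 s (le_of_max_le_right hs)
    have hdec : ∀ s s', s2 ≤ s → s ≤ s' → oo F p s' t = true → oo F p s t = true := by
      intro s s' hs hss ho
      obtain ⟨Y, hY, hT⟩ := oo_iff.1 ho
      refine oo_iff.2 ⟨Y, alv_anti hst hs hss hY, ?_⟩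
      exact tst_mono (by rw [hg s hs, hg s' (hs.trans hss)]) hss hT
    have hex : ∃ s3 ≥ s2, ∀ s ≥ s3, oo F p s t = oo F p s3 t := by
      by_cases hall : ∀ s ≥ s2, oo F p s t = true
      · exact ⟨s2, le_rfl, fun s hs => by rw [hall s hs, hall s2 le_rfl]⟩
      · push Not at hall
        obtain ⟨s3, h3, hf⟩ := hall
        refine ⟨s3, h3, fun s hs => ?_⟩
        rw [Bool.eq_iff_iff]
        exact ⟨fun h => hdec s3 s h3 hs h, fun h => absurd h hf⟩
    obtain ⟨s3, h3, h4⟩ := hex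
    refine ⟨s3, fun s hs u hu => ?_⟩
    by_cases hut : u = t
    · subst hut
      exact ⟨h4 s hs, by rw [hg s (h3.trans hs), hg s3 h3]⟩
    · exact (hst.mono h3 le_rfl) s hs u (by omega)

open Classical in
/-- limit outcome -/
noncomputable def ol (F : ℕ → ℕ → ℕ) (p : Code) (t : ℕ) : Bool :=
  decide (∃ s0, ∀ s ≥ s0, oo F p s t = true)

theorem ol_eq {s0 t u s : ℕ} (h : Stab F p s0 t) (hs : s0 ≤ s) (hu : u < t) :
    oo F p s u = ol F p u := by
  rw [Bool.eq_iff_iff]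
  simp only [ol, decide_eq_true_eq]
  constructor
  · intro h1
    refine ⟨s0, fun s' hs' => ?_⟩
    rw [(h s' hs' u hu).1, ← (h s hs u hu).1, h1]
  · rintro ⟨s1, h1⟩
    rw [(h s hs u hu).1, ← (h (max s0 s1) (le_max_left _ _) u hu).1]
    exact h1 _ (le_max_right _ _)

/-- the limit set -/
noncomputable def Zl (F : ℕ → ℕ → ℕ) (p : Code) (j : ℕ) : Bool := !(ol F p (tn j 0))

theorem Zl_alv (H : Good F p) {s0 t s : ℕ} (h : Stab F p s0 t) (hs : s0 ≤ s) :
    Alv F p s t (Zl F p) := by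
  obtain ⟨s1, h1⟩ := stab_ex H (max t (tri (s + t + 1)))
  obtain ⟨Y, hY⟩ := alv_ex H (max s s1) (max t (tri (s + t + 1)))
  refine alv_local (Y := Y) (fun j hj => ?_)
    (alv_anti h hs (le_max_left _ _) (hY.mono (le_max_left _ _)))
  have hjt : tn j 0 < max t (tri (s + t + 1)) :=
    lt_of_lt_of_le (tn_lt_of (i' := 0) (j' := s + t + 1) (Nat.zero_le _) (Or.inl hj))
      (le_max_right _ _)
  have e := ol_eq h1 (le_max_right s s1) hjt
  unfold Zl
  rw [← e]
  have hn := node_tn (Nat.zero_le j)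
  have hz : (node (tn j 0)).2 = 0 := by rw [hn]
  have tz : ∀ g s, tst (tn j 0) g s Y = !(Y j) := by
    intro g s
    rw [tst_zero hz, hn]
  by_cases ho : oo F p (max s s1) (tn j 0) = true
  · have := hY.2 _ hjt ho
    rw [tz] at this
    rw [ho]; simpa using this
  · have h2 : ¬ tst (tn j 0) (gg F (max s s1) (tn j 0)) (max s s1) Y = true := fun hc =>
      ho (oo_iff.2 ⟨Y, hY.mono hjt.le, hc⟩)
    rw [tz] at h2
    rw [Bool.not_eq_true] at ho
    rw [ho]; simpa using h2

theorem Zl_mem (H : Good F p) (n s : ℕ) : st p s (Encodable.encode (restr (Zl F p) n)) = false := by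
  have h0 : Stab F p 0 0 := fun s _ u hu => absurd hu (Nat.not_lt_zero _)
  have := base_iff.1 (Zl_alv H h0 (Nat.zero_le (max s n))).1 n (le_max_right _ _)
  by_contra hc
  rw [Bool.not_eq_false] at hc
  rw [st_mono (le_max_left s n) hc] at this
  exact absurd this (by decide)

theorem Zl_approx (H : Good F p) (j : ℕ) : ∃ s0, ∀ s ≥ s0, (!(oo F p s (tn j 0))) = Zl F p j := by
  obtain ⟨s0, h⟩ := stab_ex H (tn j 0 + 1)
  refine ⟨s0, fun s hs => ?_⟩
  unfold Zl
  rw [ol_eq h hs (Nat.lt_succ_self _)]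

end sem
end PO


namespace PO
open Nat.Partrec (Code)

theorem evt_unif {P : ℕ → ℕ → Prop} (N : ℕ) (h : ∀ x < N, ∃ s0, ∀ s ≥ s0, P s x) :
    ∃ s0, ∀ s ≥ s0, ∀ x < N, P s x := by
  induction N with
  | zero => exact ⟨0, fun _ _ x hx => absurd hx (Nat.not_lt_zero _)⟩
  | succ N ih =>
    obtain ⟨s0, h0⟩ := ih fun x hx => h x (by omega)
    obtain ⟨s1, h1⟩ := h N (by omega)
    refine ⟨max s0 s1, fun s hs x hx => ?_⟩
    by_cases hxN : x = N
    · subst hxN; exact h1 s (le_of_max_le_right hs)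
    · exact h0 s (le_of_max_le_left hs) x (by omega)

theorem geom_le (N : ℕ) : ∑ k ∈ Finset.range N, ((1 : ℚ) / 2) ^ k ≤ 2 := by
  have : ∑ k ∈ Finset.range N, ((1 : ℚ) / 2) ^ k = 2 - 2 * (1 / 2) ^ N := by
    induction N with
    | zero => simp
    | succ N ih => rw [Finset.sum_range_succ, ih, pow_succ]; ring
  rw [this]
  have : (0 : ℚ) ≤ (1 / 2) ^ N := by positivity
  linarith

theorem geom_le' (G : Finset ℕ) : ∑ k ∈ G, ((1 : ℚ) / 2) ^ k ≤ 2 := by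
  refine le_trans ?_ (geom_le (G.sup id + 1))
  apply Finset.sum_le_sum_of_subset_of_nonneg
  · intro k hk
    rw [Finset.mem_range]
    have : id k ≤ G.sup id := Finset.le_sup hk
    simp only [id] at this
    omega
  · intros; positivity

/-- weight of a charge -/
def cw (u : ℕ × ℕ × ℕ) : ℚ := (1 / 2) ^ u.1 * ((1 / 2) ^ u.2.1 * (1 / 2) ^ u.2.2)

theorem cw_nonneg (u : ℕ × ℕ × ℕ) : 0 ≤ cw u := by unfold cw; positivity

theorem cw_sum (G : Finset (ℕ × ℕ × ℕ)) : ∑ u ∈ G, cw u ≤ 8 := by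
  let G1 := G.image fun u => u.1
  let G2 := G.image fun u => u.2.1
  let G3 := G.image fun u => u.2.2
  have hsub : G ⊆ G1 ×ˢ (G2 ×ˢ G3) := by
    intro u hu
    simp only [Finset.mem_product]
    exact ⟨Finset.mem_image_of_mem _ hu, Finset.mem_image_of_mem _ hu, Finset.mem_image_of_mem _ hu⟩
  calc ∑ u ∈ G, cw u ≤ ∑ u ∈ G1 ×ˢ (G2 ×ˢ G3), cw u :=
        Finset.sum_le_sum_of_subset_of_nonneg hsub fun _ _ _ => cw_nonneg _
    _ = (∑ k ∈ G1, ((1 : ℚ) / 2) ^ k) * ((∑ k ∈ G2, ((1 : ℚ) / 2) ^ k) *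
          (∑ k ∈ G3, ((1 : ℚ) / 2) ^ k)) := by
        simp only [Finset.sum_product, cw, ← Finset.sum_mul, ← Finset.mul_sum]
    _ ≤ 2 * (2 * 2) := by
        have h0 : ∀ G : Finset ℕ, (0 : ℚ) ≤ ∑ k ∈ G, ((1 : ℚ) / 2) ^ k :=
          fun G => Finset.sum_nonneg fun _ _ => by positivity
        exact mul_le_mul (geom_le' _) (mul_le_mul (geom_le' _) (geom_le' _) (h0 _) (by norm_num))
          (mul_nonneg (h0 _) (h0 _)) (by norm_num)
    _ = 8 := by norm_num

theorem sum_bound (f : ℕ → ℚ) (R : ℕ → ℕ × ℕ × ℕ → Prop)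
    (inj : ∀ n n' u, R n u → R n' u → n = n')
    (h : ∀ n, f n ≤ 2 * (1 / 2) ^ n ∨ ∃ u, R n u ∧ f n ≤ cw u) (G : Finset ℕ) :
    ∑ n ∈ G, f n ≤ 12 := by
  classical
  rw [← Finset.sum_filter_add_sum_filter_not G (fun n => f n ≤ 2 * (1 / 2) ^ n)]
  have h1 : ∑ n ∈ G with f n ≤ 2 * (1 / 2) ^ n, f n ≤ 4 := by
    calc _ ≤ ∑ n ∈ G with f n ≤ 2 * (1 / 2) ^ n, 2 * ((1 : ℚ) / 2) ^ n :=
          Finset.sum_le_sum fun n hn => (Finset.mem_filter.1 hn).2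
      _ = 2 * ∑ n ∈ G with f n ≤ 2 * (1 / 2) ^ n, ((1 : ℚ) / 2) ^ n := by rw [Finset.mul_sum]
      _ ≤ 4 := by have := geom_le' (G.filter fun n => f n ≤ 2 * (1 / 2) ^ n); linarith
  have h2 : ∑ n ∈ G with ¬ f n ≤ 2 * (1 / 2) ^ n, f n ≤ 8 := by
    have h' : ∀ n, ∃ u, ¬ f n ≤ 2 * (1 / 2) ^ n → R n u ∧ f n ≤ cw u := by
      intro n
      rcases h n with h | ⟨u, h⟩
      · exact ⟨(0,0,0), fun h' => absurd h h'⟩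
      · exact ⟨u, fun _ => h⟩
    choose v hv using h'
    calc _ ≤ ∑ n ∈ G with ¬ f n ≤ 2 * (1 / 2) ^ n, cw (v n) :=
          Finset.sum_le_sum fun n hn => (hv n (Finset.mem_filter.1 hn).2).2
      _ = ∑ u ∈ (G.filter fun n => ¬ f n ≤ 2 * (1 / 2) ^ n).image v, cw u := by
          rw [Finset.sum_image]
          intro n hn n' hn' e
          refine inj n n' (v n) (hv n (Finset.mem_filter.1 hn).2).1 ?_
          have e : v n = v n' := e
          rw [e]
          exact (hv n' (Finset.mem_filter.1 hn').2).1
      _ ≤ 8 := cw_sum _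
  linarith

section main
variable {F : ℕ → ℕ → ℕ} {p : Code}

theorem ol_mono_j (H : Good F p) {j j' i : ℕ} (hi : 1 ≤ i) (h : i ≤ j) (hj : j ≤ j')
    (ho : ol F p (tn j i) = true) : ol F p (tn j' i) = true := by
  induction j', hj using Nat.le_induction with
  | base => exact ho
  | succ k hk ih =>
    obtain ⟨s0, hs⟩ := stab_ex H (tn (k + 1) i + 1)
    rw [← ol_eq hs le_rfl (Nat.lt_succ_self _)]
    apply oo_mono_j H hi (h.trans hk)
    rw [ol_eq hs le_rfl ((tn_lt_of (h.trans hk) (Or.inl (by omega))).trans (Nat.lt_succ_self _))]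
    exact ih

theorem cost_g {c : ℕ → ℕ → ℚ} (hc : CostFunction c) (hFc : ∀ s q, c (F s q) s ≤ (1 / 2) ^ q)
    {j i : ℕ} (h : i ≤ j) (s : ℕ) : c (gg F s (tn j i)) s ≤
      (1 / 2) ^ (wt (tri j + (j - i)) + SS F s (tri j + (j - i))) := by
  rw [gg_tn h, SS_succ]
  exact (hc.2.2.2 _ _ _ (by omega)).trans (hFc _ _)

theorem half_pow_le {m n : ℕ} (h : m ≤ n) : ((1 : ℚ) / 2) ^ n ≤ (1 / 2) ^ m :=
  pow_le_pow_of_le_one (by norm_num) (by norm_num) h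

/-- Data for the verification of one c.e. set. -/
structure Dat (F : ℕ → ℕ → ℕ) (p a w : Code) (i J s0 : ℕ) (sq : ℕ → ℕ) : Prop where
  i1 : 1 ≤ i
  ra : rqA (i - 1) = a
  rw : rqW (i - 1) = w
  iJ : i ≤ J
  stab : Stab F p s0 (tri (J + 1))
  olf : ol F p (tn J i) = false
  sett : ∀ s ≥ s0, ∀ x < gg F s (tn J i), st a s x = true → st a s0 x = true
  sq0 : ∀ n, s0 ≤ sq n
  sqm : StrictMono sq
  sqn : ∀ n, n + 1 ≤ sq n
  d1 : ∀ n, ∀ d ≤ n, ∀ k, 1 ≤ k → k ≤ i → oo F p (sq n) (tn (J + d) k) = oo F p (sq n) (tn J k)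
  d2 : ∀ n, ∃ Y, Alv F p (sq n) (tn (J + n) i) Y ∧
    ∀ x, ¬ (st a (sq n) x = true ∧ phi w (sq n) Y x = true)

/-- the change at `n` is charged to `u` -/
def Chg (F : ℕ → ℕ → ℕ) (p a : Code) (i J : ℕ) (sq : ℕ → ℕ) (n : ℕ) (u : ℕ × ℕ × ℕ) : Prop :=
  ∃ k, n = k + 1 ∧ ∃ x, st a (sq k) x = false ∧ st a (sq (k + 1)) x = true ∧
    J ≤ u.1 ∧ u.1 + 1 ≤ J + k ∧
    x < gg F (sq k) (tn (u.1 + 1) i) ∧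
    u.2.1 = SS F (sq k) (tri u.1 + (u.1 - i)) ∧
    u.2.2 = OO F p (sq k) (tn (u.1 + 1) i)

theorem tn_lt_tri {j i : ℕ} (h : i ≤ j) : tn j i < tri (j + 1) := by
  rw [tri_succ]; unfold tn; omega

theorem chg_inj_aux (H : Good F p) {a w : Code} {i J s0 : ℕ} {sq : ℕ → ℕ}
    (D : Dat F p a w i J s0 sq) {n n' : ℕ} {u : ℕ × ℕ × ℕ} (h : Chg F p a i J sq n u)
    (h' : Chg F p a i J sq n' u) (hn : n < n') : False := by
  obtain ⟨j, m, q⟩ := u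
  obtain ⟨k, rfl, x, hx1, hx2, hj1, hj2, hxg, hm, hq⟩ := h
  obtain ⟨k', rfl, x', -, -, -, hj2', -, hm', hq'⟩ := h'
  simp only at hj1 hj2 hxg hm hq hj2' hm' hq'
  have i1 := D.i1
  have iJ := D.iJ
  have hss : sq k < sq k' := D.sqm (by omega)
  have hss' : sq (k + 1) ≤ sq k' := D.sqm.monotone (by omega)
  have hm2 : SS F (sq k) (tri j + (j - i)) = SS F (sq k') (tri j + (j - i)) := hm.symm.trans hm'
  have hq2 : OO F p (sq k) (tn (j + 1) i) = OO F p (sq k') (tn (j + 1) i) := hq.symm.trans hq'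
  have hoo : ∀ v < tn (j + 1) i, oo F p (sq k) v = oo F p (sq k') v := by
    intro v hv
    rw [OO_eq, OO_eq] at hq2
    rw [← bs_testBit (Y := oo F p (sq k)) hv, hq2, bs_testBit hv]
  obtain ⟨Y, hY, hV⟩ := D.d2 k'
  have hYt : Alv F p (sq k') (tn (j + 1) i) Y := by
    refine hY.mono ?_
    unfold tn
    have := tri_mono hj2'
    omega
  have hYs : Alv F p (sq k) (tn (j + 1) i) Y := by
    refine ⟨base_anti hss.le hYt.1, fun v hv ho => ?_⟩
    have ho' : oo F p (sq k') v = true := by rw [← hoo v hv]; exact ho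
    have ht := hYt.2 v hv ho'
    obtain ⟨hn1, hn2⟩ := node_spec v
    set j' := (node v).1 with hj'
    set i' := (node v).2 with hi'
    rw [← hn2] at ho ht hv ⊢
    rcases Nat.eq_zero_or_pos i' with hz | hpos
    · have hz' : (node (tn j' i')).2 = 0 := by rw [node_tn hn1]; exact hz
      rw [tst_zero hz'] at ht ⊢
      exact ht
    have hlt := tn_lt hn1 hv (by omega)
    by_cases hjJ : j' ≤ J
    · have hvt : tn j' i' < tri (J + 1) :=
        lt_of_lt_of_le (tn_lt_tri hn1) (tri_mono (by omega))
      have e1 := (D.stab _ (D.sq0 k) _ hvt).2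
      have e2 := (D.stab _ (D.sq0 k') _ hvt).2
      exact tst_mono (by rw [e1, e2]) hss.le ht
    by_cases hii : i < i'
    · have hidx : tri j' + (j' - i') + 1 ≤ tri j + (j - i) := by
        rcases Nat.lt_or_ge j' j with h1 | h1
        · have := tri_mono (show j' + 1 ≤ j from h1)
          rw [tri_succ] at this
          omega
        · have : j' = j := by omega
          rw [this]
          omega
      have e := SS_agree H hss.le _ hm2 _ hidx
      refine tst_mono ?_ hss.le ht
      rw [gg_tn hn1, gg_tn hn1, e]
    · have hjd : oo F p (sq k) (tn (J + (j' - J)) i') = oo F p (sq k) (tn J i') :=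
        D.d1 k (j' - J) (by omega) i' hpos (by omega)
      rw [show J + (j' - J) = j' by omega] at hjd
      have hiJ : i' ≤ J := by omega
      have hvJ : tn J i' < tn (j + 1) i := tn_lt_of hiJ (Or.inl (by omega))
      have ho2 : oo F p (sq k') (tn J i') = true := by rw [← hoo _ hvJ, ← hjd]; exact ho
      have ht2 := hYt.2 _ hvJ ho2
      have hvt : tn J i' < tri (J + 1) := tn_lt_tri hiJ
      have e1 := (D.stab _ (D.sq0 k) _ hvt).2
      have e2 := (D.stab _ (D.sq0 k') _ hvt).2
      rw [tst_same hpos hn1 hiJ]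
      refine tst_mono ?_ hss.le ht2
      rw [e2, ← e1]
      exact gg_mono_j hiJ (by omega) _
  have hof : oo F p (sq k) (tn (j + 1) i) = false := by
    have := D.d1 k (j + 1 - J) (by omega) i i1 le_rfl
    rw [show J + (j + 1 - J) = j + 1 by omega] at this
    rw [this, ol_eq D.stab (D.sq0 k) (tn_lt_tri iJ), D.olf]
  have hnt : ¬ tst (tn (j + 1) i) (gg F (sq k) (tn (j + 1) i)) (sq k) Y = true := by
    intro hc
    have := oo_iff.2 ⟨Y, hYs, hc⟩
    rw [hof] at this
    exact absurd this (by decide)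
  have hnode : node (tn (j + 1) i) = (j + 1, i) := node_tn (by omega)
  rw [tst_pos (by rw [hnode]; simp; omega), hnode] at hnt
  simp only [D.ra, D.rw] at hnt
  have hphi : phi w (sq k) Y x = true := by
    by_contra hc
    rw [Bool.not_eq_true] at hc
    exact hnt ⟨x, hxg, hx1, hc⟩
  exact hV x ⟨st_mono hss' hx2, phi_mono hss.le hphi⟩

theorem chg_inj (H : Good F p) {a w : Code} {i J s0 : ℕ} {sq : ℕ → ℕ}
    (D : Dat F p a w i J s0 sq) (n n' : ℕ) (u : ℕ × ℕ × ℕ) (h : Chg F p a i J sq n u)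
    (h' : Chg F p a i J sq n' u) : n = n' := by
  rcases lt_trichotomy n n' with h1 | h1 | h1
  · exact (chg_inj_aux H D h h' h1).elim
  · exact h1
  · exact (chg_inj_aux H D h' h h1).elim

theorem chg_cost {c : ℕ → ℕ → ℚ} (hc : CostFunction c)
    (hFc : ∀ s q, c (F s q) s ≤ (1 / 2) ^ q) {a w : Code} {i J s0 : ℕ} {sq : ℕ → ℕ}
    (D : Dat F p a w i J s0 sq) (n : ℕ) :
    stageCost c (fun n x => st a (sq n) x) n ≤ 2 * (1 / 2) ^ n ∨
      ∃ u, Chg F p a i J sq n u ∧ stageCost c (fun n x => st a (sq n) x) n ≤ cw u := by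
  classical
  have triv : (0 : ℚ) ≤ 2 * (1 / 2) ^ n := by positivity
  unfold stageCost
  by_cases hn : n = 0
  · left; rw [if_pos hn]; exact triv
  rw [if_neg hn]
  obtain ⟨k, rfl⟩ : ∃ k, n = k + 1 := ⟨n - 1, by omega⟩
  split_ifs with hex
  swap
  · left; exact triv
  have hsp := Nat.find_spec hex
  set x := Nat.find hex with hxdef
  rw [Nat.add_sub_cancel] at hsp
  simp only at hsp
  have hle : sq k ≤ sq (k + 1) := D.sqm.monotone (by omega)
  have hx1 : st a (sq k) x = false := by
    by_contra hcon
    rw [Bool.not_eq_false] at hcon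
    exact hsp (by rw [hcon, st_mono hle hcon])
  have hx2 : st a (sq (k + 1)) x = true := by
    by_contra hcon
    rw [Bool.not_eq_true] at hcon
    exact hsp (by rw [hcon, hx1])
  have iJ := D.iJ
  have hcs : c x (k + 1) ≤ c x (sq k) := hc.2.2.1 _ _ _ (D.sqn k)
  have hxK : gg F (sq k) (tn J i) ≤ x := by
    by_contra hcon
    push Not at hcon
    have hvt : tn J i < tri (J + 1) := tn_lt_tri iJ
    have e1 := (D.stab _ (D.sq0 k) _ hvt).2
    have e2 := (D.stab _ (D.sq0 (k+1)) _ hvt).2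
    have := D.sett _ (D.sq0 (k + 1)) x (by rw [e2, ← e1]; exact hcon) hx2
    rw [st_mono (D.sq0 k) this] at hx1
    exact absurd hx1 (by decide)
  by_cases hbig : gg F (sq k) (tn (J + k) i) ≤ x
  · left
    refine hcs.trans ((hc.2.2.2 _ _ _ hbig).trans ((cost_g hc hFc (by omega) _).trans ?_))
    have e : (2 : ℚ) * (1 / 2) ^ (k + 1) = (1 / 2) ^ k := by rw [pow_succ]; ring
    rw [e]
    apply half_pow_le
    unfold wt
    have := le_tri (J + k)
    generalize 2 ^ tri (tri (J + k) + (J + k - i) + 2) = o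
    omega
  · right
    push Not at hbig
    have hexj : ∃ d, x < gg F (sq k) (tn (J + d) i) := ⟨k, hbig⟩
    have hd1 := Nat.find_spec hexj
    have hd2 : Nat.find hexj ≤ k := Nat.find_min' _ hbig
    have hd3 : ∀ d < Nat.find hexj, ¬ x < gg F (sq k) (tn (J + d) i) :=
      fun d hd => Nat.find_min hexj hd
    generalize Nat.find hexj = d at hd1 hd2 hd3
    have hd0 : d ≠ 0 := by
      rintro rfl
      exact absurd hd1 (not_lt.2 hxK)
    obtain ⟨d, rfl⟩ : ∃ d', d = d' + 1 := ⟨d - 1, by omega⟩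
    have hlow := not_lt.1 (hd3 d (by omega))
    refine ⟨(J + d, SS F (sq k) (tri (J + d) + (J + d - i)), OO F p (sq k) (tn (J + d + 1) i)),
      ⟨k, rfl, x, hx1, hx2, by simp, by simp; omega, hd1, rfl, rfl⟩, ?_⟩
    refine hcs.trans ((hc.2.2.2 _ _ _ hlow).trans ((cost_g hc hFc (by omega) _).trans ?_))
    unfold cw
    simp only
    rw [← pow_add, ← pow_add]
    apply half_pow_le
    have h1 : OO F p (sq k) (tn (J + d + 1) i) < 2 ^ tri (J + d + 2) := by
      rw [OO_eq]
      refine (bs_lt _ _).trans_le (Nat.pow_le_pow_right (by norm_num) ?_)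
      exact (tn_lt_tri (by omega)).le
    have h2 := le_tri (J + d)
    have h3 : 2 ^ tri (J + d + 2) ≤ 2 ^ tri (tri (J + d) + (J + d - i) + 2) :=
      Nat.pow_le_pow_right (by norm_num) (tri_mono (by omega))
    unfold wt
    omega

end main
end PO


namespace PO
open Nat.Partrec (Code)

theorem phi_lim {w : Code} {Z : ℕ → Bool} {x : ℕ}
    (h : ∃ n s, st w s (Encodable.encode (restr Z n, x)) = true) :
    ∃ s0, ∀ s ≥ s0, phi w s Z x = true := by
  obtain ⟨n, s, h⟩ := h
  exact ⟨max n s, fun s' hs' => phi_iff.2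
    ⟨n, le_of_max_le_left hs', st_mono (le_of_max_le_right hs') h⟩⟩

section main
variable {F : ℕ → ℕ → ℕ} {p : Code}

/-- good stages -/
def DD (F : ℕ → ℕ → ℕ) (p a w : Code) (i J n s : ℕ) : Bool :=
  (bAll (n + 1) fun d => bAll i fun k =>
    decide (oo F p s (tn (J + d) (k + 1)) = oo F p s (tn J (k + 1)))) &&
  bEx (2 ^ (s + tn (J + n) i + 1)) fun m =>
    alvN F p (OO F p s (tn (J + n) i)) s (tn (J + n) i) m.testBit &&
    bAll s fun x => !(st a s x && phi w s m.testBit x)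

theorem c_tn {α} [Primcodable α] {j i : α → ℕ} (hj : Computable j) (hi : Computable i) :
    Computable fun a => tn (j a) (i a) := c_add (c_tri.comp hj) hi

theorem c_DD (hF : Computable₂ F) (a w : Code) (i J : ℕ) {α} [Primcodable α] {n s : α → ℕ}
    (hn : Computable n) (hs : Computable s) : Computable fun b => DD F p a w i J (n b) (s b) := by
  unfold DD
  have f1 : Computable (Prod.fst : α × ℕ → α) := Computable.fst
  have f2 : Computable (Prod.snd : α × ℕ → ℕ) := Computable.snd
  have g1 : Computable (Prod.fst : (α × ℕ) × ℕ → α × ℕ) := Computable.fst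
  have g2 : Computable (Prod.snd : (α × ℕ) × ℕ → ℕ) := Computable.snd
  have k1 : ∀ m : ℕ, ∀ {β : Type _} [Primcodable β], Computable fun _ : β => m :=
    fun m _ _ => Computable.const m
  refine c_and (c_bAll (c_add hn (k1 1)) (c_bAll (k1 i) (c_beq ?_ ?_))) (c_bEx ?_ (c_and ?_ ?_))
  · exact c_oo hF (hs.comp (f1.comp g1)) (c_tn (c_add (k1 J) (f2.comp g1)) (c_add g2 (k1 1)))
  · exact c_oo hF (hs.comp (f1.comp g1)) (c_tn (k1 J) (c_add g2 (k1 1)))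
  · exact c_pow (k1 2) (c_add (c_add hs (c_tn (c_add (k1 J) hn) (k1 i))) (k1 1))
  · have ht : Computable fun b : α × ℕ => tn (J + n b.1) i :=
      c_tn (c_add (k1 J) (hn.comp f1)) (k1 i)
    exact c_alvN (Y := fun q : α × ℕ => q.2.testBit) hF (c_OO hF (hs.comp f1) ht) (hs.comp f1) ht
      (c_testBit (f2.comp g1) g2)
  · refine c_bAll (hs.comp f1) (c_not (c_and ?_ ?_))
    · exact c_st (Computable.const a) (hs.comp (f1.comp g1)) g2
    · refine c_phi (Y := fun q : (α × ℕ) × ℕ => q.1.2.testBit) (Computable.const w)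
        (hs.comp (f1.comp g1)) g2 ?_
      exact c_testBit (f2.comp (g1.comp Computable.fst)) Computable.snd

theorem DD_iff {a w : Code} {i J n s : ℕ} : DD F p a w i J n s = true ↔
    (∀ d ≤ n, ∀ k, 1 ≤ k → k ≤ i → oo F p s (tn (J + d) k) = oo F p s (tn J k)) ∧
    ∃ Y, Alv F p s (tn (J + n) i) Y ∧ ∀ x, ¬ (st a s x = true ∧ phi w s Y x = true) := by
  unfold DD
  rw [Bool.and_eq_true]
  refine and_congr ?_ ?_
  · simp only [bAll_iff, decide_eq_true_eq]
    constructor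
    · intro h d hd k hk hki
      have := h d (by omega) (k - 1) (by omega)
      rwa [Nat.sub_add_cancel hk] at this
    · intro h d hd k hk
      exact h d (by omega) (k + 1) (by omega) (by omega)
  · simp only [bEx_iff, Bool.and_eq_true, alvN_iff, bAll_iff]
    constructor
    · rintro ⟨m, _, h1, h2⟩
      refine ⟨_, h1, fun x hx => ?_⟩
      have := h2 x (st_bound hx.1)
      rw [hx.1, hx.2] at this
      exact absurd this (by decide)
    · rintro ⟨Y, h1, h2⟩
      refine ⟨bs (s + tn (J + n) i + 1) Y, bs_lt _ _, ?_, ?_⟩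
      · exact alv_local (fun k hk => (bs_testBit hk).symm) h1
      · intro x _
        rw [phi_local (Y' := Y) fun k hk => bs_testBit (by omega)]
        have := h2 x
        cases h3 : st a s x <;> cases h4 : phi w s Y x <;> simp_all

theorem main_obeys (H : Good F p) (hF : Computable₂ F) {c : ℕ → ℕ → ℚ} (hc : CostFunction c)
    (hFc : ∀ s q, c (F s q) s ≤ (1 / 2) ^ q) {A : ℕ → Bool} {a w : Code}
    (ha : ∀ x, A x = true ↔ ∃ s, st a s x = true)
    (hw : ∀ x, A x = false ↔ ∃ n s, st w s (Encodable.encode (restr (Zl F p) n, x)) = true) :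
    Obeys A c := by
  obtain ⟨r, hra, hrw⟩ := rq_surj a w
  set i := r + 1 with hi
  have i1 : 1 ≤ i := by omega
  have hir : i - 1 = r := by omega
  -- limit outcomes of the requirement
  have hol : ∀ j, i ≤ j → ol F p (tn j i) = false := by
    intro j hj
    by_contra hcon
    rw [Bool.not_eq_false] at hcon
    obtain ⟨s0, hs0⟩ := stab_ex H (tn j i + 1)
    have hx : ∀ x < gg F s0 (tn j i), ∃ s1, ∀ s ≥ s1,
        st a s x = true ∨ phi w s (Zl F p) x = true := by
      intro x _
      cases hA : A x with
      | true =>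
        obtain ⟨s, hs⟩ := (ha x).1 hA
        exact ⟨s, fun s' hs' => Or.inl (st_mono hs' hs)⟩
      | false =>
        obtain ⟨s, hs⟩ := phi_lim ((hw x).1 hA)
        exact ⟨s, fun s' hs' => Or.inr (hs s' hs')⟩
    obtain ⟨s1, hs1⟩ := evt_unif _ hx
    set s := max s0 s1
    have hZ := Zl_alv H hs0 (le_max_left s0 s1)
    have ht := hZ.2 (tn j i) (Nat.lt_succ_self _)
      (by rw [ol_eq hs0 (le_max_left s0 s1) (Nat.lt_succ_self _)]; exact hcon)
    rw [tst_pos (by rw [node_tn hj]; simp), node_tn hj] at ht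
    simp only [hir, hra, hrw] at ht
    obtain ⟨x, hx, h1, h2⟩ := ht
    rw [(hs0 _ (le_max_left s0 s1) _ (Nat.lt_succ_self _)).2] at hx
    rcases hs1 _ (le_max_right s0 s1) x hx with h | h
    · rw [h] at h1; exact absurd h1 (by decide)
    · rw [h] at h2; exact absurd h2 (by decide)
  -- choice of J
  have hJ : ∃ J ≥ i, ∀ j ≥ J, ∀ k, 1 ≤ k → k ≤ i → ol F p (tn j k) = ol F p (tn J k) := by
    have h1 : ∀ k < i + 1, ∃ J, ∀ j ≥ J,
        1 ≤ k → (ol F p (tn j k) = true ↔ ∃ j' ≥ k, ol F p (tn j' k) = true) := by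
      intro k _
      by_cases h : ∃ j' ≥ k, ol F p (tn j' k) = true
      · obtain ⟨j', hj', ho⟩ := h
        exact ⟨j', fun j hj hk => ⟨fun _ => ⟨j', hj', ho⟩, fun _ => ol_mono_j H hk hj' hj ho⟩⟩
      · exact ⟨k, fun j hj _ => ⟨fun ho => ⟨j, hj, ho⟩, fun h' => absurd h' h⟩⟩
    obtain ⟨J, hJ⟩ := evt_unif _ h1
    refine ⟨max J i, le_max_right _ _, fun j hj k hk hki => ?_⟩
    rw [Bool.eq_iff_iff, hJ j (le_of_max_le_left hj) k (by omega) hk,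
      hJ _ (le_max_left _ _) k (by omega) hk]
  obtain ⟨J, hiJ, hJ⟩ := hJ
  -- choice of s0
  obtain ⟨sA, hsA⟩ := stab_ex H (tri (J + 1))
  have hset : ∀ x < gg F sA (tn J i), ∃ s1, ∀ s ≥ s1, (A x = true → st a s x = true) := by
    intro x _
    by_cases hA : A x = true
    · obtain ⟨s, hs⟩ := (ha x).1 hA
      exact ⟨s, fun s' hs' _ => st_mono hs' hs⟩
    · exact ⟨0, fun _ _ h => absurd h hA⟩
  obtain ⟨sB, hsB⟩ := evt_unif _ hset
  set s0 := max sA sB with hs0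
  have hst0 : Stab F p s0 (tri (J + 1)) := hsA.mono (le_max_left _ _) le_rfl
  have hsett : ∀ s ≥ s0, ∀ x < gg F s (tn J i), st a s x = true → st a s0 x = true := by
    intro s hs x hx hsx
    rw [(hsA s (le_of_max_le_left hs) _ (tn_lt_tri hiJ)).2] at hx
    exact hsB s0 (le_max_right _ _) x hx ((ha x).2 ⟨s, hsx⟩)
  -- good stages exist
  have hDD : ∀ q : ℕ × ℕ, ∃ s, (decide (q.2 < s) && DD F p a w i J q.1 s) = true := by
    rintro ⟨n, b⟩
    obtain ⟨s1, hs1⟩ := stab_ex H (tri (J + n + 1))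
    have hs : s1 ≤ max s1 (b + 1) := le_max_left _ _
    have hb : b < max s1 (b + 1) := lt_of_lt_of_le (Nat.lt_succ_self b) (le_max_right _ _)
    generalize max s1 (b + 1) = s at hs hb
    refine ⟨s, ?_⟩
    rw [Bool.and_eq_true, decide_eq_true_eq, DD_iff]
    refine ⟨hb, fun d hd k hk hki => ?_, Zl F p, ?_, ?_⟩
    · have hlt : ∀ d ≤ n, tn (J + d) k < tri (J + n + 1) := fun d hd =>
        lt_of_lt_of_le (tn_lt_tri (by omega)) (tri_mono (by omega))
      have h0 : tn J k < tri (J + n + 1) := hlt 0 (Nat.zero_le _)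
      rw [ol_eq hs1 hs (hlt d hd), ol_eq hs1 hs h0]
      exact hJ _ (by omega) k hk hki
    · exact (Zl_alv H hs1 hs).mono (tn_lt_tri (by omega)).le
    · rintro x ⟨h1, h2⟩
      have hA1 := (ha x).2 ⟨s, h1⟩
      obtain ⟨n', _, h3⟩ := phi_iff.1 h2
      have hA2 := (hw x).2 ⟨n', s, h3⟩
      rw [hA1] at hA2
      exact absurd hA2 (by decide)
  have hcf : Computable fun q : ℕ × ℕ => Nat.find (hDD q) := by
    refine comp_find (P := fun (q : ℕ × ℕ) s => decide (q.2 < s) && DD F p a w i J q.1 s) ?_ hDD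
    exact c_and (c_lt (Computable.snd.comp Computable.fst) Computable.snd)
      (c_DD hF a w i J (Computable.fst.comp Computable.fst) Computable.snd)
  obtain ⟨fd, hfd⟩ : ∃ fd : ℕ × ℕ → ℕ, fd = fun q => Nat.find (hDD q) := ⟨_, rfl⟩
  rw [← hfd] at hcf
  have hfs : ∀ n b, b < fd (n, b) ∧ DD F p a w i J n (fd (n, b)) = true := by
    intro n b
    have := Nat.find_spec (hDD (n, b))
    rw [Bool.and_eq_true, decide_eq_true_eq] at this
    rw [hfd]; exact this
  obtain ⟨sq, hsq⟩ : ∃ sq : ℕ → ℕ, sq = fun n => Nat.rec (fd (0, s0)) (fun n r => fd (n + 1, r)) n :=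
    ⟨_, rfl⟩
  have hq0 : sq 0 = fd (0, s0) := congrFun hsq 0
  have hqs : ∀ n, sq (n + 1) = fd (n + 1, sq n) := by intro n; rw [hsq]
  have hcq : Computable sq := by
    rw [hsq]
    refine Computable.nat_rec (α := ℕ) (f := fun n => n) (g := fun _ => fd (0, s0))
      (h := fun _ q => fd (q.1 + 1, q.2)) Computable.id (Computable.const _) ?_
    exact hcf.comp (Computable.pair (c_add (Computable.fst.comp Computable.snd) (Computable.const 1))
      (Computable.snd.comp Computable.snd))
  have hqD : ∀ n, DD F p a w i J n (sq n) = true := by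
    intro n
    cases n with
    | zero => rw [hq0]; exact (hfs _ _).2
    | succ n => rw [hqs]; exact (hfs _ _).2
  have hqm : StrictMono sq := strictMono_nat_of_lt_succ fun n => by rw [hqs]; exact (hfs _ _).1
  have hq1 : s0 < sq 0 := by rw [hq0]; exact (hfs _ _).1
  have hqn : ∀ n, n + 1 ≤ sq n := by
    intro n
    induction n with
    | zero => omega
    | succ n ih => have := hqm (show n < n + 1 by omega); omega
  have D : Dat F p a w i J s0 sq :=
    { i1 := i1
      ra := by rw [hir, hra]
      rw := by rw [hir, hrw]
      iJ := hiJ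
      stab := hst0
      olf := hol J hiJ
      sett := hsett
      sq0 := fun n => hq1.le.trans (hqm.monotone (Nat.zero_le n))
      sqm := hqm
      sqn := hqn
      d1 := fun n => (DD_iff.1 (hqD n)).1
      d2 := fun n => (DD_iff.1 (hqD n)).2 }
  refine ⟨fun n x => st a (sq n) x, ⟨?_, ?_⟩, 12, ?_⟩
  · exact c_st (Computable.const a) (hcq.comp Computable.fst) Computable.snd
  · intro x
    cases hA : A x with
    | true =>
      obtain ⟨s, hs⟩ := (ha x).1 hA
      exact ⟨s, fun n hn => st_mono (by have := hqn n; omega) hs⟩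
    | false =>
      refine ⟨0, fun n _ => ?_⟩
      by_contra hcon
      rw [Bool.not_eq_false] at hcon
      rw [(ha x).2 ⟨_, hcon⟩] at hA
      exact absurd hA (by decide)
  · intro G
    exact sum_bound _ _ (chg_inj H D) (chg_cost hc hFc D) G

end main

theorem marker_ex {c : ℕ → ℕ → ℚ} (hc : CostFunction c) (hlim : LimitCondition c) (q : ℕ × ℕ) :
    ∃ x, leQ (c x q.1) q.2 = true := by
  obtain ⟨x, hx⟩ := hlim ((1 / 2) ^ q.2) (by positivity)
  exact ⟨x, (leQ_iff (hc.2.1 _ _) _).2 (hx x le_rfl q.1)⟩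

end PO

/-- For any non-empty Π⁰₁ class and any cost function `c` with the
limit condition, some Δ⁰₂ member `Z` has all c.e. sets below it obeying `c`. -/
theorem pi01_member_forcing_obedience (P : Set (ℕ → Bool)) (hP : Pi01 P)
    (hne : P.Nonempty)
    (c : ℕ → ℕ → ℚ) (hc : CostFunction c) (hlim : LimitCondition c) :
    ∃ Z ∈ P, Delta02 Z ∧ ∀ A : ℕ → Bool, CE A → TuringLE A Z → Obeys A c := by
  obtain ⟨f, hf, rfl⟩ := hP
  obtain ⟨p, hp⟩ := PO.code_of_pi01 hf
  have hex := PO.marker_ex hc hlim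
  have hcf : Computable fun q : ℕ × ℕ => Nat.find (hex q) := by
    refine PO.comp_find (P := fun (q : ℕ × ℕ) x => PO.leQ (c x q.1) q.2) ?_ hex
    exact PO.c_leQ (hc.1.comp Computable.snd (Computable.fst.comp Computable.fst))
      (Computable.snd.comp Computable.fst)
  obtain ⟨F, hFdef⟩ : ∃ F : ℕ → ℕ → ℕ, F = fun s q => Nat.find (hex (s, q)) := ⟨_, rfl⟩
  have hF : Computable₂ F := by rw [hFdef]; exact hcf
  have hFc : ∀ s q, c (F s q) s ≤ (1 / 2) ^ q := by
    intro s q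
    have := Nat.find_spec (hex (s, q))
    rw [PO.leQ_iff (hc.2.1 _ _)] at this
    rw [hFdef]; exact this
  have hFmin : ∀ s q x, c x s ≤ (1 / 2) ^ q → F s q ≤ x := by
    intro s q x hx
    rw [hFdef]
    exact Nat.find_min' _ ((PO.leQ_iff (hc.2.1 _ _) _).2 hx)
  have hFm : ∀ s s' q q', s ≤ s' → q ≤ q' → F s q ≤ F s' q' := by
    intro s s' q q' hs hq
    exact hFmin _ _ _ ((hc.2.2.1 _ _ _ hs).trans ((hFc s' q').trans (PO.half_pow_le hq)))
  have hmem : ∀ Z : ℕ → Bool, (∀ i σ, f i = some σ → ¬ InitSeg σ Z) ↔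
      ∀ n s, PO.st p s (Encodable.encode (restr Z n)) = false := by
    intro Z
    constructor
    · intro h n s
      by_contra hcon
      rw [Bool.not_eq_false] at hcon
      obtain ⟨i, hi⟩ := (hp _).2 (PO.st_complete.2 ⟨s, hcon⟩)
      refine h i _ hi ?_
      unfold InitSeg
      rw [PO.restr_length]
    · intro h i σ hi hσ
      obtain ⟨s, hs⟩ := PO.st_complete.1 ((hp σ).1 ⟨i, hi⟩)
      unfold InitSeg at hσ
      rw [hσ, h] at hs
      exact absurd hs (by decide)
  have H : PO.Good F p := by
    refine ⟨hFm, ?_, ?_⟩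
    · intro q
      obtain ⟨x, hx⟩ := hlim ((1 / 2) ^ q) (by positivity)
      have hb : ∀ s, F s q ≤ x := fun s => hFmin _ _ _ (hx x le_rfl s)
      have hbdd : ∃ m, ∃ s0, F s0 q = m ∧ ∀ s, F s q ≤ m := by
        have hfin : (Set.range fun s => F s q).Finite :=
          (Set.finite_Iic x).subset (by rintro _ ⟨s, rfl⟩; exact hb s)
        obtain ⟨m, ⟨s0, hs0⟩, hmax⟩ := hfin.exists_maximal ⟨_, ⟨0, rfl⟩⟩
        refine ⟨m, s0, hs0, fun s => ?_⟩
        rcases le_total (F s q) m with h | h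
        · exact h
        · exact hmax ⟨s, rfl⟩ h
      obtain ⟨m, s0, h0, hm⟩ := hbdd
      refine ⟨s0, fun s hs => le_antisymm ?_ (hFm _ _ _ _ hs le_rfl)⟩
      rw [h0]; exact hm s
    · obtain ⟨Z0, hZ0⟩ := hne
      exact ⟨Z0, (hmem Z0).1 hZ0⟩
  refine ⟨PO.Zl F p, (hmem _).2 (PO.Zl_mem H), ?_, ?_⟩
  · refine ⟨fun s j => !(PO.oo F p s (PO.tn j 0)), ?_, PO.Zl_approx H⟩
    exact PO.c_not (PO.c_oo hF Computable.fst (PO.c_tn Computable.snd (Computable.const 0)))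
  · intro A hA hT
    obtain ⟨a, ha⟩ := PO.code_of_ce hA
    obtain ⟨w, hw⟩ := PO.code_of_turing hT
    refine PO.main_obeys H hF hc hFc (a := a) (w := w) (fun x => ?_) (fun x => ?_)
    · rw [ha, PO.st_complete]
    · rw [hw]
      simp only [PO.st_complete]
end

section
/- For every computably enumerable set A that is not computable, there is a Martin-Löf random Δ⁰₂ set Z such that A is not Turing reducible to Z. -/
namespace RAUC

/-- `F k` is an increasing approximation to the partial value `f`. -/
def Rep {α : Type} (F : ℕ → Part α) (f : Part α) : Prop :=
  (∀ j k y, j ≤ k → y ∈ F j → y ∈ F k) ∧ ∀ y, y ∈ f ↔ ∃ k, y ∈ F k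

theorem Rep.const {α : Type} (f : Part α) : Rep (fun _ => f) f :=
  ⟨fun _ _ _ _ h => h, fun _ => ⟨fun h => ⟨0, h⟩, fun ⟨_, h⟩ => h⟩⟩

theorem Rep.bind {α β : Type} {F : ℕ → Part α} {f : Part α} {G : ℕ → α → Part β}
    {g : α → Part β} (hF : Rep F f) (hG : ∀ i, Rep (fun k => G k i) (g i)) :
    Rep (fun k => (F k).bind (G k)) (f.bind g) := by
  constructor
  · intro j k y hjk h
    rw [Part.mem_bind_iff] at h ⊢
    obtain ⟨a, ha, hy⟩ := h
    exact ⟨a, hF.1 _ _ _ hjk ha, (hG a).1 _ _ _ hjk hy⟩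
  · intro y
    simp only [Part.mem_bind_iff]
    constructor
    · rintro ⟨a, ha, hy⟩
      obtain ⟨k, hk⟩ := (hF.2 a).1 ha
      obtain ⟨l, hl⟩ := ((hG a).2 y).1 hy
      exact ⟨max k l, a, hF.1 _ _ _ (le_max_left _ _) hk,
        (hG a).1 _ _ _ (le_max_right _ _) hl⟩
    · rintro ⟨k, a, ha, hy⟩
      exact ⟨a, (hF.2 a).2 ⟨k, ha⟩, ((hG a).2 y).2 ⟨k, hy⟩⟩

theorem Rep.rfind {F : ℕ → ℕ →. Bool} {f : ℕ →. Bool}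
    (h : ∀ m, Rep (fun k => F k m) (f m)) :
    Rep (fun k => Nat.rfind (F k)) (Nat.rfind f) := by
  constructor
  · intro j k y hjk hy
    simp only [Nat.mem_rfind] at hy ⊢
    exact ⟨(h y).1 _ _ _ hjk hy.1, fun hm => (h _).1 _ _ _ hjk (hy.2 hm)⟩
  · intro y
    constructor
    · intro hy
      simp only [Nat.mem_rfind] at hy
      obtain ⟨k, hk⟩ := ((h y).2 _).1 hy.1
      have : ∀ m, ∃ l, m < y → false ∈ F l m := by
        intro m
        by_cases hm : m < y
        · obtain ⟨l, hl⟩ := ((h m).2 _).1 (hy.2 hm)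
          exact ⟨l, fun _ => hl⟩
        · exact ⟨0, fun h => absurd h hm⟩
      choose l hl using this
      refine ⟨max k ((Finset.range y).sup l), ?_⟩
      simp only [Nat.mem_rfind]
      refine ⟨(h y).1 _ _ _ (le_max_left _ _) hk, fun {m} hm => ?_⟩
      refine (h m).1 _ _ _ ?_ (hl m hm)
      exact le_trans (Finset.le_sup (f := l) (Finset.mem_range.2 hm)) (le_max_right _ _)
    · rintro ⟨k, hk⟩
      simp only [Nat.mem_rfind] at hk ⊢
      exact ⟨((h y).2 _).2 ⟨k, hk.1⟩, fun hm => ((h _).2 _).2 ⟨k, hk.2 hm⟩⟩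

theorem restr_length (Z : ℕ → Bool) (k : ℕ) : (restr Z k).length = k := by simp [restr]

theorem restr_getElem? (Z : ℕ → Bool) (k n : ℕ) :
    (restr Z k)[n]? = if n < k then some (Z n) else none := by
  unfold restr
  split_ifs with h
  · simp [h]
  · simp; omega

theorem pair_seq (a b : Part ℕ) :
    (Nat.pair <$> a <*> b : Part ℕ) = a.bind fun x => b.bind fun y => Part.some (Nat.pair x y) := by
  ext y
  simp [Seq.seq, eq_comm]

/-- The use principle. -/
theorem use_principle (Z : ℕ → Bool) {f : ℕ →. ℕ} (h : RecIn (charFn Z) f) :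
    ∃ g : List Bool → ℕ →. ℕ, Partrec₂ g ∧ ∀ n, Rep (fun k => g (restr Z k) n) (f n) := by
  induction h with
  | oracle =>
    refine ⟨fun σ n => ((σ[n]?).map fun b => cond b 1 0 : Option ℕ), ?_, ?_⟩
    · have : Primrec₂ fun (σ : List Bool) (n : ℕ) => ((σ[n]?).map fun b => cond b 1 0 : Option ℕ) :=
        Primrec.option_map Primrec.list_getElem?
          ((Primrec.dom_bool fun b => cond b 1 0).comp Primrec.snd).to₂
      exact this.to_comp.ofOption
    · intro n
      simp only [restr_getElem?]
      constructor
      · intro j k y hjk hy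
        beta_reduce at hy ⊢
        split_ifs at hy ⊢ with h1 h2 h2
        · exact hy
        · simp at hy
        · omega
        · exact hy
      · intro y
        simp only [charFn]
        constructor
        · intro h
          exact ⟨n + 1, by simpa [eq_comm] using h⟩
        · rintro ⟨k, hk⟩
          split_ifs at hk
          · simpa [eq_comm] using hk
          · simp at hk
  | zero => exact ⟨fun _ _ => Part.some 0, (Computable.const 0).partrec.to₂, fun n => Rep.const _⟩
  | succ => exact ⟨fun _ n => Part.some n.succ,
      (Computable.succ.comp Computable.snd).partrec.to₂, fun n => Rep.const _⟩
  | left => exact ⟨fun _ n => Part.some n.unpair.1,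
      (Computable.fst.comp (Computable.unpair.comp Computable.snd)).partrec.to₂,
      fun n => Rep.const _⟩
  | right => exact ⟨fun _ n => Part.some n.unpair.2,
      (Computable.snd.comp (Computable.unpair.comp Computable.snd)).partrec.to₂,
      fun n => Rep.const _⟩
  | pair _ _ ihf ihg =>
    obtain ⟨gf, hf, rf⟩ := ihf
    obtain ⟨gg, hg, rg⟩ := ihg
    refine ⟨fun σ n => (gf σ n).bind fun x => (gg σ n).bind fun y => Part.some (Nat.pair x y),
      ?_, ?_⟩
    · refine Partrec.bind (g := fun (p : List Bool × ℕ) x =>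
        (gg p.1 p.2).bind fun y => Part.some (Nat.pair x y)) hf ?_
      refine Partrec.bind (f := fun q : (List Bool × ℕ) × ℕ => gg q.1.1 q.1.2)
        (g := fun q y => Part.some (Nat.pair q.2 y)) (hg.comp (Computable.fst.comp Computable.fst)
          (Computable.snd.comp Computable.fst)) ?_
      exact (Primrec₂.natPair.to_comp.comp (Computable.snd.comp Computable.fst)
        Computable.snd).partrec
    · intro n
      refine Eq.subst (motive := fun x => Rep _ x) (pair_seq _ _).symm ?_
      exact (rf n).bind fun x => (rg n).bind fun y => Rep.const _
  | comp _ _ ihf ihg =>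
    obtain ⟨gf, hf, rf⟩ := ihf
    obtain ⟨gg, hg, rg⟩ := ihg
    refine ⟨fun σ n => (gg σ n).bind (gf σ), ?_, ?_⟩
    · refine Partrec.bind (g := fun (p : List Bool × ℕ) x => gf p.1 x) hg ?_
      exact hf.comp (Computable.fst.comp Computable.fst) Computable.snd
    · intro n
      exact (rg n).bind fun x => rf x
  | prec _ _ ihf ihg =>
    obtain ⟨gf, hf, rf⟩ := ihf
    obtain ⟨gg, hg, rg⟩ := ihg
    refine ⟨fun σ p => Nat.rec (gf σ p.unpair.1) (fun y IH => IH.bind fun i =>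
      gg σ (Nat.pair p.unpair.1 (Nat.pair y i))) p.unpair.2, ?_, ?_⟩
    · refine Partrec.nat_rec (α := List Bool × ℕ) (f := fun q => q.2.unpair.2)
        (g := fun q => gf q.1 q.2.unpair.1)
        (h := fun q r => gg q.1 (Nat.pair q.2.unpair.1 (Nat.pair r.1 r.2))) ?_ ?_ ?_
      · exact Computable.snd.comp (Computable.unpair.comp Computable.snd)
      · exact hf.comp Computable.fst
          (Computable.fst.comp (Computable.unpair.comp Computable.snd))
      · refine hg.comp (Computable.fst.comp Computable.fst) ?_
        refine Primrec₂.natPair.to_comp.comp ?_ ?_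
        · exact Computable.fst.comp (Computable.unpair.comp (Computable.snd.comp Computable.fst))
        · exact Primrec₂.natPair.to_comp.comp (Computable.fst.comp Computable.snd)
            (Computable.snd.comp Computable.snd)
    · intro p
      simp only [Nat.unpaired]
      induction p.unpair.2 with
      | zero => exact rf _
      | succ m ih => exact ih.bind fun i => rg _
  | rfind _ ihf =>
    obtain ⟨gf, hf, rf⟩ := ihf
    refine ⟨fun σ a => Nat.rfind fun n => (gf σ (Nat.pair a n)).map fun m => decide (m = 0),
      ?_, ?_⟩
    · refine Partrec.rfind (α := List Bool × ℕ)
        (p := fun q n => (gf q.1 (Nat.pair q.2 n)).map fun m => decide (m = 0)) ?_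
      refine Partrec.map (f := fun r : (List Bool × ℕ) × ℕ => gf r.1.1 (Nat.pair r.1.2 r.2))
        (g := fun _ m => decide (m = 0)) ?_ ?_
      · exact hf.comp (Computable.fst.comp Computable.fst)
          (Primrec₂.natPair.to_comp.comp (Computable.snd.comp Computable.fst) Computable.snd)
      · exact ((Primrec.eq.comp Primrec.snd (Primrec.const 0)).decide).to_comp
    · intro a
      refine Rep.rfind fun m => ?_
      have := (rf (Nat.pair a m)).bind (fun x => Rep.const (Part.some (decide (x = 0))))
      simpa [Part.bind_some_eq_map] using this
open Nat.Partrec in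
/-- The `j`-th string of the `p`-th test, if it has been computed by stage `s`. -/
def seqAt (s p j : ℕ) : Option (List Bool) :=
  (Code.evaln s (Denumerable.ofNat Code p.unpair.1) j).bind Encodable.decode

/-- Scaled weight of the `j`-th string of the `p`-th test at stage `s`. -/
def wt (s p j : ℕ) : ℕ :=
  (seqAt s p j).elim (2 ^ (p + s) + 1)
    fun τ => if τ.length ≤ s then 2 ^ (s - τ.length) else 2 ^ (p + s) + 1

/-- Scaled total weight. -/
def WS (s p n : ℕ) : ℕ := ∑ j ∈ Finset.range n, wt s p j

/-- The `i`-th string of the `p`-th test is active and is an initial segment of `σ`. -/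
def Hit (i : ℕ) (q : List Bool × ℕ) : Prop :=
  WS q.1.length q.2 (i + 1) ≤ 2 ^ (q.2.unpair.2 + q.1.length) ∧
    ∃ k < q.1.length + 1, seqAt q.1.length q.2 i = some (q.1.take k)

open Classical in
/-- Number of hits. -/
noncomputable def cnt (σ : List Bool) (p : ℕ) : ℕ :=
  ((Finset.range σ.length).filter fun i => Hit i (σ, p)).card

/-- `σ` is not (yet) rejected by the universal test. -/
def MlOK (σ : List Bool) : Prop := ∀ p < σ.length, cnt σ p ≤ 2 ^ (2 * p + 2)

open Nat.Partrec in
/-- The `e`-th functional with oracle string `σ` on input `n`. -/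
def G (e : ℕ) (σ : List Bool) (n : ℕ) : Option ℕ :=
  (List.range (σ.length + 1)).findSome? fun t =>
    Code.evaln t.unpair.2 (Denumerable.ofNat Code e)
      (Nat.pair (Encodable.encode (σ.take t.unpair.1)) n)

/-- The value of the characteristic function as a number. -/
def bv (b : Bool) : ℕ := cond b 1 0

/-- The tree of conditions. -/
def T (B : ℕ → Bool) (l : List ℕ) (σ : List Bool) : Prop :=
  MlOK σ ∧ ∀ j < l.length, (σ[j]? = none ∨ σ[j]? = some (l.getD j 0).bodd) ∧
    G j σ (l.getD j 0).div2 ≠ some (bv (B (l.getD j 0).div2))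

theorem unpair2_le (p : ℕ) : p.unpair.2 ≤ p := Nat.unpair_right_le p

theorem wt_pos_info {s p j : ℕ} (h : wt s p j ≤ 2 ^ (p + s)) :
    ∃ τ, seqAt s p j = some τ ∧ τ.length ≤ s ∧ wt s p j = 2 ^ (s - τ.length) := by
  unfold wt at *
  cases hs : seqAt s p j with
  | none => simp [hs] at h
  | some τ =>
    simp only [hs, Option.elim] at h ⊢
    split_ifs at h ⊢ with h1
    · exact ⟨τ, rfl, h1, rfl⟩
    · omega

theorem seqAt_mono {s s' p j : ℕ} {τ : List Bool} (h : s ≤ s') (hs : seqAt s p j = some τ) :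
    seqAt s' p j = some τ := by
  unfold seqAt at *
  rw [Option.bind_eq_some_iff] at hs ⊢
  obtain ⟨a, ha, hd⟩ := hs
  exact ⟨a, Nat.Partrec.Code.evaln_mono h ha, hd⟩

theorem WS_info {s p n : ℕ} (h : WS s p n ≤ 2 ^ (p.unpair.2 + s)) (j : ℕ) (hj : j < n) :
    ∃ τ, seqAt s p j = some τ ∧ τ.length ≤ s ∧ wt s p j = 2 ^ (s - τ.length) := by
  apply wt_pos_info
  calc wt s p j ≤ WS s p n :=
        Finset.single_le_sum (f := wt s p) (fun _ _ => Nat.zero_le _) (Finset.mem_range.2 hj)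
    _ ≤ _ := h
    _ ≤ _ := Nat.pow_le_pow_right (by norm_num) (by have := unpair2_le p; omega)

theorem WS_mono_stage {s s' p n : ℕ} (hss : s ≤ s') (h : WS s p n ≤ 2 ^ (p.unpair.2 + s)) :
    WS s' p n ≤ 2 ^ (p.unpair.2 + s') := by
  have : WS s' p n = 2 ^ (s' - s) * WS s p n := by
    unfold WS
    rw [Finset.mul_sum]
    apply Finset.sum_congr rfl
    intro j hj
    obtain ⟨τ, h1, h2, h3⟩ := WS_info h j (Finset.mem_range.1 hj)
    rw [h3, wt, seqAt_mono hss h1]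
    simp only [Option.elim]
    rw [if_pos (by omega), ← pow_add]
    congr 1; omega
  rw [this]
  calc 2 ^ (s' - s) * WS s p n ≤ 2 ^ (s' - s) * 2 ^ (p.unpair.2 + s) := by gcongr
    _ = _ := by rw [← pow_add]; congr 1; omega

theorem Hit_mono {i p : ℕ} {ρ σ : List Bool} (h : ρ <+: σ) (hh : Hit i (ρ, p)) :
    Hit i (σ, p) := by
  obtain ⟨h1, k, hk, h2⟩ := hh
  have hl := h.length_le
  simp only at *
  refine ⟨WS_mono_stage hl h1, k, by simp only; omega, ?_⟩
  simp only
  rw [seqAt_mono hl h2]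
  obtain ⟨r, rfl⟩ := h
  rw [List.take_append_of_le_length (by omega)]

theorem cnt_mono {p : ℕ} {ρ σ : List Bool} (h : ρ <+: σ) : cnt ρ p ≤ cnt σ p := by
  classical
  unfold cnt
  apply Finset.card_le_card
  intro i hi
  simp only [Finset.mem_filter, Finset.mem_range] at hi ⊢
  exact ⟨lt_of_lt_of_le hi.1 h.length_le, Hit_mono h hi.2⟩

theorem MlOK_mono {ρ σ : List Bool} (h : ρ <+: σ) (hs : MlOK σ) : MlOK ρ := fun p hp =>
  (cnt_mono h).trans (hs p (lt_of_lt_of_le hp h.length_le))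

theorem G_mono {e n y : ℕ} {ρ σ : List Bool} (h : ρ <+: σ) (hg : G e ρ n = some y) :
    G e σ n = some y := by
  obtain ⟨r, rfl⟩ := h
  unfold G at *
  have : List.range ((ρ ++ r).length + 1) =
      List.range (ρ.length + 1) ++ (List.range r.length).map (ρ.length + 1 + ·) := by
    rw [← List.range_add]; congr 1; simp; omega
  rw [this, List.findSome?_append]
  have e2 : ∀ t ∈ List.range (ρ.length + 1), (ρ ++ r).take t.unpair.1 = ρ.take t.unpair.1 := by
    intro t ht
    rw [List.mem_range] at ht
    exact List.take_append_of_le_length (by have := Nat.unpair_left_le t; omega)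
  have e3 : ∀ L : List ℕ, (∀ t ∈ L, (ρ ++ r).take t.unpair.1 = ρ.take t.unpair.1) →
      (L.findSome? fun t => Nat.Partrec.Code.evaln t.unpair.2
        (Denumerable.ofNat Nat.Partrec.Code e)
        (Nat.pair (Encodable.encode ((ρ ++ r).take t.unpair.1)) n)) =
      (L.findSome? fun t => Nat.Partrec.Code.evaln t.unpair.2
        (Denumerable.ofNat Nat.Partrec.Code e)
        (Nat.pair (Encodable.encode (ρ.take t.unpair.1)) n)) := by
    intro L
    induction L with
    | nil => simp
    | cons a L ih =>
      intro hL
      simp only [List.findSome?_cons]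
      rw [hL a (by simp), ih (fun t ht => hL t (by simp [ht]))]
  rw [e3 _ e2, hg]
  simp

theorem T_mono {B : ℕ → Bool} {l : List ℕ} {ρ σ : List Bool} (h : ρ <+: σ) (hs : T B l σ) :
    T B l ρ := by
  refine ⟨MlOK_mono h hs.1, fun j hj => ⟨?_, fun hg => (hs.2 j hj).2 (G_mono h hg)⟩⟩
  rcases lt_or_ge j ρ.length with hjl | hjl
  · obtain ⟨r, rfl⟩ := h
    have := (hs.2 j hj).1
    rwa [List.getElem?_append_left hjl] at this
  · left; simp [hjl]

/-- All strings of length `s`. -/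
def S (s : ℕ) : Finset (List Bool) := Finset.univ.image fun f : Fin s → Bool => List.ofFn f

theorem mem_S {s : ℕ} {σ : List Bool} : σ ∈ S s ↔ σ.length = s := by
  unfold S
  simp only [Finset.mem_image, Finset.mem_univ, true_and]
  constructor
  · rintro ⟨f, rfl⟩; simp
  · rintro rfl; exact ⟨σ.get, by simp⟩

theorem card_S (s : ℕ) : (S s).card = 2 ^ s := by
  unfold S
  rw [Finset.card_image_of_injective _ List.ofFn_injective]
  simp

theorem card_ext {s : ℕ} {τ : List Bool} (h : τ.length ≤ s) :
    ((S s).filter fun σ => τ <+: σ).card ≤ 2 ^ (s - τ.length) := by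
  rw [← card_S]
  have : ((S s).filter fun σ => τ <+: σ) ⊆ (S (s - τ.length)).image (τ ++ ·) := by
    intro σ hσ
    rw [Finset.mem_filter, mem_S] at hσ
    obtain ⟨h1, r, rfl⟩ := hσ
    rw [Finset.mem_image]
    exact ⟨r, by rw [mem_S]; simp at h1; omega, rfl⟩
  exact (Finset.card_le_card this).trans Finset.card_image_le

theorem sum_cnt (s p : ℕ) : ∑ σ ∈ S s, cnt σ p ≤ 2 ^ (p + s) := by
  classical
  -- the set of active indices
  let A := (Finset.range s).filter fun i => WS s p (i + 1) ≤ 2 ^ (p.unpair.2 + s)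
  have h1 : ∑ σ ∈ S s, cnt σ p ≤ ∑ i ∈ A, wt s p i := by
    have : ∀ σ ∈ S s, cnt σ p ≤ ∑ i ∈ A, if Hit i (σ, p) then 1 else 0 := by
      intro σ hσ
      rw [mem_S] at hσ
      rw [← Finset.card_filter]
      unfold cnt
      apply Finset.card_le_card
      intro i hi
      simp only [Finset.mem_filter, A] at hi ⊢
      rw [hσ] at hi
      refine ⟨⟨hi.1, ?_⟩, hi.2⟩
      have := hi.2.1
      simpa [hσ] using this
    refine (Finset.sum_le_sum this).trans ?_
    rw [Finset.sum_comm]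
    apply Finset.sum_le_sum
    intro i hi
    simp only [Finset.mem_filter, A] at hi
    obtain ⟨τ, t1, t2, t3⟩ := WS_info hi.2 i (Nat.lt_succ_self i)
    rw [t3, ← Finset.card_filter]
    refine le_trans (Finset.card_le_card ?_) (card_ext t2)
    intro σ hσ
    rw [Finset.mem_filter] at hσ ⊢
    refine ⟨hσ.1, ?_⟩
    obtain ⟨-, k, -, hk⟩ := hσ.2
    have hl := mem_S.1 hσ.1
    simp only at hk
    rw [hl, t1] at hk
    cases hk
    exact ⟨_, List.take_append_drop _ _⟩
  refine h1.trans ?_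
  rcases A.eq_empty_or_nonempty with he | hne
  · rw [he]; simp
  · have hm := A.max'_mem hne
    set m := A.max' hne
    have h2 : A ⊆ Finset.range (m + 1) := by
      intro i hi
      exact Finset.mem_range.2 (Nat.lt_succ_of_le (A.le_max' i hi))
    calc ∑ i ∈ A, wt s p i ≤ WS s p (m + 1) := Finset.sum_le_sum_of_subset h2
      _ ≤ 2 ^ (p.unpair.2 + s) := by
        simp only [Finset.mem_filter, A] at hm; exact hm.2
      _ ≤ _ := Nat.pow_le_pow_right (by norm_num) (by have := unpair2_le p; omega)

theorem geom_bound (s : ℕ) : ∑ p ∈ Finset.range s, ((1 : ℝ) / 2) ^ (p + 2) < 1 := by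
  have : ∀ s : ℕ, ∑ p ∈ Finset.range s, ((1 : ℝ) / 2) ^ (p + 2) = 1 / 2 - (1 / 2) ^ (s + 1) := by
    intro s
    induction s with
    | zero => norm_num
    | succ s ih => rw [Finset.sum_range_succ, ih]; ring
  rw [this]
  have : (0 : ℝ) < (1 / 2) ^ (s + 1) := by positivity
  linarith

theorem MlOK_exists (s : ℕ) : ∃ σ : List Bool, σ.length = s ∧ MlOK σ := by
  classical
  by_contra! hcon
  have h1 : ∀ σ ∈ S s, (1 : ℝ) ≤ ∑ p ∈ Finset.range s, (cnt σ p : ℝ) / 2 ^ (2 * p + 2) := by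
    intro σ hσ
    have hl := mem_S.1 hσ
    have := hcon σ hl
    unfold MlOK at this
    push Not at this
    obtain ⟨p, hp, hc⟩ := this
    rw [hl] at hp
    have : (1 : ℝ) ≤ (cnt σ p : ℝ) / 2 ^ (2 * p + 2) := by
      rw [one_le_div (by positivity)]
      exact_mod_cast hc.le
    exact this.trans (Finset.single_le_sum
      (f := fun p => (cnt σ p : ℝ) / 2 ^ (2 * p + 2)) (fun _ _ => by positivity)
      (Finset.mem_range.2 hp))
  have h2 := Finset.sum_le_sum h1
  rw [Finset.sum_comm] at h2
  simp only [Finset.sum_const, card_S, nsmul_eq_mul, mul_one] at h2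
  have h3 : ∀ p ∈ Finset.range s, ∑ σ ∈ S s, (cnt σ p : ℝ) / 2 ^ (2 * p + 2) ≤
      2 ^ s * (1 / 2 : ℝ) ^ (p + 2) := by
    intro p _
    rw [← Finset.sum_div, div_le_iff₀ (by positivity)]
    have := sum_cnt s p
    have h4 : (∑ σ ∈ S s, (cnt σ p : ℝ)) ≤ 2 ^ (p + s) := by exact_mod_cast this
    refine h4.trans (le_of_eq ?_)
    have : (2 : ℝ) ^ (2 * p + 2) = 2 ^ p * 2 ^ (p + 2) := by rw [← pow_add]; congr 1; omega
    rw [this, pow_add, one_div, inv_pow]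
    field_simp
  have h5 := h2.trans (Finset.sum_le_sum h3)
  rw [← Finset.mul_sum] at h5
  have := geom_bound s
  have h6 : (0 : ℝ) < 2 ^ s := by positivity
  push_cast at h5
  nlinarith

theorem restr_succ (Z : ℕ → Bool) (k : ℕ) : restr Z (k + 1) = restr Z k ++ [Z k] := by
  simp [restr, List.range_succ]

theorem restr_pre (Z : ℕ → Bool) {j k : ℕ} (h : j ≤ k) : restr Z j <+: restr Z k := by
  induction k, h using Nat.le_induction with
  | base => exact List.prefix_refl _
  | succ k _ ih => rw [restr_succ]; exact ih.trans (List.prefix_append _ _)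

theorem restr_congr {Y Z : ℕ → Bool} {k : ℕ} (h : ∀ i < k, Y i = Z i) : restr Y k = restr Z k := by
  unfold restr
  apply List.map_congr_left
  intro i hi
  exact h i (List.mem_range.1 hi)

/-- König's lemma. -/
theorem konig (P : List Bool → Prop) (hm : ∀ ρ σ, ρ <+: σ → P σ → P ρ)
    (h : ∀ s, ∃ σ : List Bool, σ.length = s ∧ P σ) : ∃ Z : ℕ → Bool, ∀ k, P (restr Z k) := by
  classical
  let E : List Bool → Prop := fun σ => ∀ s, ∃ ρ, s ≤ ρ.length ∧ σ <+: ρ ∧ P ρ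
  have hE0 : E [] := fun s => by
    obtain ⟨σ, h1, h2⟩ := h s
    exact ⟨σ, h1.ge, ⟨_, rfl⟩, h2⟩
  have step : ∀ σ, E σ → ∃ b, E (σ ++ [b]) := by
    intro σ hσ
    by_contra! hc
    have hf := hc false
    have ht := hc true
    simp only [E, not_forall] at hf ht
    obtain ⟨s1, h1⟩ := hf
    obtain ⟨s2, h2⟩ := ht
    obtain ⟨ρ, r1, ⟨r, rfl⟩, r3⟩ := hσ (max (max s1 s2) (σ.length + 1))
    cases r with
    | nil => simp at r1
    | cons b r =>
      cases b with
      | false => exact h1 ⟨_, by omega, ⟨r, by simp⟩, r3⟩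
      | true => exact h2 ⟨_, by omega, ⟨r, by simp⟩, r3⟩
  choose! nb hnb using step
  let st : ℕ → List Bool := fun k => Nat.rec [] (fun _ σ => σ ++ [nb σ]) k
  have hst : ∀ k, E (st k) := by
    intro k
    induction k with
    | zero => exact hE0
    | succ k ih => exact hnb _ ih
  refine ⟨fun k => nb (st k), fun k => ?_⟩
  have : ∀ k, restr (fun k => nb (st k)) k = st k := by
    intro k
    induction k with
    | zero => rfl
    | succ k ih => rw [restr_succ, ih]
  rw [this]
  obtain ⟨ρ, -, h2, h3⟩ := hst k 0
  exact hm _ _ h2 h3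

theorem mlrandom_of_MlOK {Z : ℕ → Bool} (h : ∀ k, MlOK (restr Z k)) : MLRandom Z := by
  classical
  intro σ hσ hsum
  by_contra hinf
  have hinf : {i | InitSeg (σ i) Z}.Infinite := hinf
  obtain ⟨c, hc⟩ := Nat.Partrec.Code.exists_code.1 hσ
  have hc' : ∀ i, Encodable.encode (σ i) ∈ c.eval i := by
    intro i; rw [hc]; simp
  obtain ⟨C, hC⟩ := pow_unbounded_of_one_lt (∑' i, ((1 : ℝ) / 2) ^ (σ i).length)
    (one_lt_two)
  set p := Nat.pair (Encodable.encode c) C with hp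
  have hp1 : Denumerable.ofNat Nat.Partrec.Code p.unpair.1 = c := by simp [hp]
  have hp2 : p.unpair.2 = C := by simp [hp]
  obtain ⟨F, hF, hcard⟩ := hinf.exists_subset_card_eq (2 ^ (2 * p + 2) + 1)
  set N := F.sup id + 1 with hN
  have hst : ∀ j, ∃ s, seqAt s p j = some (σ j) := by
    intro j
    obtain ⟨k, hk⟩ := Nat.Partrec.Code.evaln_complete.1 (hc' j)
    refine ⟨k, ?_⟩
    unfold seqAt
    rw [hp1, Option.mem_def.1 hk]
    simp
  choose st hst using hst
  set s := max (max N (p + 1)) (max ((Finset.range N).sup st)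
    ((Finset.range N).sup fun j => (σ j).length)) with hs
  have hsN : N ≤ s := le_trans (le_max_left _ _) (le_max_left _ _)
  have hsp : p + 1 ≤ s := le_trans (le_max_right _ _) (le_max_left _ _)
  have hss : ∀ j < N, seqAt s p j = some (σ j) := fun j hj =>
    seqAt_mono (le_trans (Finset.le_sup (f := st) (Finset.mem_range.2 hj))
      (le_trans (le_max_left _ _) (le_max_right _ _))) (hst j)
  have hsl : ∀ j < N, (σ j).length ≤ s := fun j hj =>
    le_trans (Finset.le_sup (f := fun j => (σ j).length) (Finset.mem_range.2 hj))
      (le_trans (le_max_right _ _) (le_max_right _ _))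
  have hW : ∀ n ≤ N, WS s p n ≤ 2 ^ (C + s) := by
    intro n hn
    have e1 : (WS s p n : ℝ) = 2 ^ s * ∑ j ∈ Finset.range n, ((1 : ℝ) / 2) ^ (σ j).length := by
      unfold WS
      rw [Finset.mul_sum]
      push_cast
      apply Finset.sum_congr rfl
      intro j hj
      have hj' : j < N := lt_of_lt_of_le (Finset.mem_range.1 hj) hn
      rw [wt, hss j hj']
      simp only [Option.elim]
      rw [if_pos (hsl j hj')]
      push_cast
      rw [pow_sub₀ _ (by norm_num) (hsl j hj'), one_div, inv_pow]
    have e2 : ∑ j ∈ Finset.range n, ((1 : ℝ) / 2) ^ (σ j).length ≤ 2 ^ C :=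
      (hsum.sum_le_tsum _ (fun _ _ => by positivity)).trans hC.le
    have e3 : (WS s p n : ℝ) ≤ 2 ^ (C + s) := by
      rw [e1, pow_add, mul_comm]; gcongr
    exact_mod_cast e3
  have hb := h s p (by rw [restr_length]; omega)
  have : F.card ≤ cnt (restr Z s) p := by
    unfold cnt
    apply Finset.card_le_card
    intro i hi
    have hiN : i < N := Nat.lt_succ_of_le (Finset.le_sup (f := id) hi)
    rw [Finset.mem_filter, Finset.mem_range, restr_length]
    refine ⟨by omega, ?_, ?_⟩
    · simp only [restr_length, hp2]
      exact hW (i + 1) hiN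
    · simp only [restr_length]
      refine ⟨(σ i).length, by have := hsl i hiN; omega, ?_⟩
      rw [hss i hiN]
      congr 1
      have h1 : InitSeg (σ i) Z := hF hi
      unfold InitSeg at h1
      have h2 := List.prefix_iff_eq_take.1 (restr_pre Z (hsl i hiN))
      rw [restr_length] at h2
      rw [← h2, ← h1]
  omega

/-! ### Primitive recursiveness -/

theorem pow_prim : Primrec₂ ((· ^ ·) : ℕ → ℕ → ℕ) := Primrec₂.unpaired'.1 Nat.Primrec.pow

theorem pow2_prim {α : Type} [Primcodable α] {f : α → ℕ} (hf : Primrec f) :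
    Primrec fun a => 2 ^ f a := pow_prim.comp (Primrec.const 2) hf

theorem evaln_prim {α : Type} [Primcodable α] {s e n : α → ℕ} (hs : Primrec s) (he : Primrec e)
    (hn : Primrec n) : Primrec fun a =>
      Nat.Partrec.Code.evaln (s a) (Denumerable.ofNat Nat.Partrec.Code (e a)) (n a) :=
  Nat.Partrec.Code.primrec_evaln.comp
    (Primrec.pair (Primrec.pair hs ((Primrec.ofNat Nat.Partrec.Code).comp he)) hn)

theorem unpair1_prim {α : Type} [Primcodable α] {f : α → ℕ} (hf : Primrec f) :
    Primrec fun a => (f a).unpair.1 := Primrec.fst.comp (Primrec.unpair.comp hf)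

theorem unpair2_prim {α : Type} [Primcodable α] {f : α → ℕ} (hf : Primrec f) :
    Primrec fun a => (f a).unpair.2 := Primrec.snd.comp (Primrec.unpair.comp hf)

theorem seqAt_prim {α : Type} [Primcodable α] {s p j : α → ℕ} (hs : Primrec s) (hp : Primrec p)
    (hj : Primrec j) : Primrec fun a => seqAt (s a) (p a) (j a) :=
  Primrec.option_bind (evaln_prim hs (unpair1_prim hp) hj)
    (Primrec.decode.comp Primrec.snd).to₂

theorem exlt_prim {α : Type} [Primcodable α] {R : ℕ → α → Prop} (h : PrimrecRel R) {f : α → ℕ}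
    (hf : Primrec f) : PrimrecPred fun a => ∃ k < f a, R k a :=
  (PrimrecRel.comp (f := fun a => List.range (f a)) (g := fun a : α => a) h.exists_mem_list
    (Primrec.list_range.comp hf) Primrec.id).of_eq fun a => by simp

theorem alllt_prim {α : Type} [Primcodable α] {R : ℕ → α → Prop} (h : PrimrecRel R) {f : α → ℕ}
    (hf : Primrec f) : PrimrecPred fun a => ∀ k < f a, R k a :=
  (PrimrecRel.comp (f := fun a => List.range (f a)) (g := fun a : α => a) h.forall_mem_list
    (Primrec.list_range.comp hf) Primrec.id).of_eq fun a => by simp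

theorem wt_prim {α : Type} [Primcodable α] {s p j : α → ℕ} (hs : Primrec s) (hp : Primrec p)
    (hj : Primrec j) : Primrec fun a => wt (s a) (p a) (j a) := by
  have hbig : Primrec fun a => 2 ^ (p a + s a) + 1 :=
    Primrec.succ.comp (pow2_prim (Primrec.nat_add.comp hp hs))
  have hlen : Primrec fun x : α × List Bool => x.2.length := Primrec.list_length.comp Primrec.snd
  have hs' : Primrec fun x : α × List Bool => s x.1 := hs.comp Primrec.fst
  have hg : Primrec₂ fun (a : α) (τ : List Bool) =>
      if τ.length ≤ s a then 2 ^ (s a - τ.length) else 2 ^ (p a + s a) + 1 :=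
    (Primrec.ite (c := fun x : α × List Bool => x.2.length ≤ s x.1)
      (Primrec.nat_le.comp hlen hs') (pow2_prim (Primrec.nat_sub.comp hs' hlen))
      (hbig.comp Primrec.fst))
  have := Primrec.option_casesOn (seqAt_prim hs hp hj) hbig hg
  refine this.of_eq fun a => ?_
  unfold wt
  cases seqAt (s a) (p a) (j a) <;> rfl

theorem WS_prim {α : Type} [Primcodable α] {s p n : α → ℕ} (hs : Primrec s) (hp : Primrec p)
    (hn : Primrec n) : Primrec fun a => WS (s a) (p a) (n a) := by
  have := Primrec.nat_rec' (f := n) (g := fun _ => 0)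
    (h := fun a (x : ℕ × ℕ) => x.2 + wt (s a) (p a) x.1) hn (Primrec.const 0)
    (Primrec.nat_add.comp (Primrec.snd.comp Primrec.snd)
      (wt_prim (hs.comp Primrec.fst) (hp.comp Primrec.fst) (Primrec.fst.comp Primrec.snd)))
  refine this.of_eq fun a => ?_
  induction n a with
  | zero => simp [WS]
  | succ m ih =>
    rw [WS, Finset.sum_range_succ]
    simp only [WS] at ih
    rw [← ih]

theorem Hit_prim : PrimrecRel Hit := by
  have hlen : Primrec fun x : ℕ × (List Bool × ℕ) => x.2.1.length :=
    Primrec.list_length.comp (Primrec.fst.comp Primrec.snd)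
  have hp : Primrec fun x : ℕ × (List Bool × ℕ) => x.2.2 := Primrec.snd.comp Primrec.snd
  have h1 : PrimrecPred fun x : ℕ × (List Bool × ℕ) =>
      WS x.2.1.length x.2.2 (x.1 + 1) ≤ 2 ^ (x.2.2.unpair.2 + x.2.1.length) :=
    Primrec.nat_le.comp (WS_prim hlen hp (Primrec.succ.comp Primrec.fst))
      (pow2_prim (Primrec.nat_add.comp (unpair2_prim hp) hlen))
  have h2 : PrimrecRel fun (k : ℕ) (x : ℕ × (List Bool × ℕ)) =>
      seqAt x.2.1.length x.2.2 x.1 = some (x.2.1.take k) :=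
    Primrec.eq.comp
      (seqAt_prim (hlen.comp Primrec.snd) (hp.comp Primrec.snd) (Primrec.fst.comp Primrec.snd))
      (Primrec.option_some.comp (Primrec.list_take.comp Primrec.fst
        (Primrec.fst.comp (Primrec.snd.comp Primrec.snd))))
  have h3 := exlt_prim h2 (Primrec.succ.comp hlen)
  exact (h1.and h3).of_eq fun x => Iff.rfl

theorem cnt_prim : Primrec₂ cnt := by
  classical
  have h := Primrec₂.comp (g := fun σ : List Bool × ℕ => List.range σ.1.length)
    (h := fun x => x) Hit_prim.listFilter (Primrec.list_range.comp (Primrec.list_length.comp Primrec.fst)) Primrec.id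
  refine (Primrec.list_length.comp h).of_eq fun x => ?_
  unfold cnt
  rw [← List.toFinset_card_of_nodup (List.nodup_range.filter _)]
  congr 1
  ext i
  simp

theorem MlOK_prim : PrimrecPred MlOK := by
  have h : PrimrecRel fun (p : ℕ) (σ : List Bool) => cnt σ p ≤ 2 ^ (2 * p + 2) :=
    Primrec.nat_le.comp (cnt_prim.comp Primrec.snd Primrec.fst)
      (pow2_prim (Primrec.nat_add.comp (Primrec.nat_mul.comp (Primrec.const 2) Primrec.fst)
        (Primrec.const 2)))
  exact (alllt_prim h Primrec.list_length).of_eq fun x => Iff.rfl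

theorem G_prim {α : Type} [Primcodable α] {e n : α → ℕ} {σ : α → List Bool} (he : Primrec e)
    (hσ : Primrec σ) (hn : Primrec n) : Primrec fun a => G (e a) (σ a) (n a) := by
  have h : Primrec₂ fun (a : α) (t : ℕ) => Nat.Partrec.Code.evaln t.unpair.2
      (Denumerable.ofNat Nat.Partrec.Code (e a))
      (Nat.pair (Encodable.encode ((σ a).take t.unpair.1)) (n a)) :=
    evaln_prim (unpair2_prim Primrec.snd) (he.comp Primrec.fst)
      (Primrec₂.natPair.comp (Primrec.encode.comp (Primrec.list_take.comp
        (unpair1_prim Primrec.snd) (hσ.comp Primrec.fst))) (hn.comp Primrec.fst))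
  have h2 := Primrec.list_head?.comp (Primrec.listFilterMap
    (Primrec.list_range.comp (Primrec.succ.comp (Primrec.list_length.comp hσ))) h)
  refine h2.of_eq fun a => ?_
  rw [List.head?_filterMap]
  rfl

theorem bv_prim : Primrec bv := Primrec.dom_bool _

theorem T_prim {As : ℕ → ℕ → Bool} (hA : Primrec₂ As) {α : Type} [Primcodable α]
    {t : α → ℕ} {l : α → List ℕ} {σ : α → List Bool} (ht : Primrec t) (hl : Primrec l)
    (hσ : Primrec σ) : PrimrecPred fun a => T (As (t a)) (l a) (σ a) := by
  have hj : Primrec fun x : ℕ × α => x.1 := Primrec.fst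
  have hc : Primrec fun x : ℕ × α => (l x.2).getD x.1 0 :=
    (Primrec.list_getD 0).comp (hl.comp Primrec.snd) Primrec.fst
  have hs : Primrec fun x : ℕ × α => (σ x.2)[x.1]? :=
    Primrec.list_getElem?.comp (hσ.comp Primrec.snd) Primrec.fst
  have hd := Primrec.nat_div2.comp hc
  have h1 : PrimrecRel fun (j : ℕ) (a : α) =>
      ((σ a)[j]? = none ∨ (σ a)[j]? = some ((l a).getD j 0).bodd) ∧
      ¬ (G j (σ a) ((l a).getD j 0).div2 = some (bv (As (t a) ((l a).getD j 0).div2))) := by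
    refine PrimrecPred.and (PrimrecPred.or (Primrec.eq.comp hs (Primrec.const none))
      (Primrec.eq.comp hs (Primrec.option_some.comp (Primrec.nat_bodd.comp hc)))) ?_
    refine PrimrecPred.not (Primrec.eq.comp (G_prim hj (hσ.comp Primrec.snd) hd) ?_)
    exact Primrec.option_some.comp (bv_prim.comp (hA.comp (ht.comp Primrec.snd) hd))
  exact ((MlOK_prim.comp hσ).and
    (alllt_prim h1 (Primrec.list_length.comp hl))).of_eq fun a => Iff.rfl

/-- List of all strings of length `s`. -/
def strs (s : ℕ) : List (List Bool) :=
  Nat.rec [[]] (fun _ L => L.flatMap fun σ => [σ ++ [false], σ ++ [true]]) s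

theorem strs_prim : Primrec strs := by
  refine Primrec.nat_rec₁ [[]] (f := fun _ L => L.flatMap fun σ => [σ ++ [false], σ ++ [true]]) ?_
  refine Primrec.list_flatMap Primrec.snd ?_
  refine Primrec.list_cons.comp (Primrec.list_concat.comp Primrec.snd (Primrec.const _)) ?_
  exact Primrec.list_cons.comp (Primrec.list_concat.comp Primrec.snd (Primrec.const _))
    (Primrec.const [])

theorem mem_strs {s : ℕ} {σ : List Bool} : σ ∈ strs s ↔ σ.length = s := by
  induction s generalizing σ with
  | zero => simp [strs]
  | succ s ih =>
    have : strs (s + 1) = (strs s).flatMap fun σ => [σ ++ [false], σ ++ [true]] := rfl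
    rw [this]
    simp only [List.mem_flatMap, ih]
    constructor
    · rintro ⟨ρ, rfl, h⟩
      simp at h
      rcases h with rfl | rfl <;> simp
    · intro h
      rcases List.eq_nil_or_concat σ with rfl | ⟨ρ, b, rfl⟩
      · simp at h
      · refine ⟨ρ, by simpa using h, ?_⟩
        cases b <;> simp

/-- Some string of length `s` is in the tree with stage-`s` approximation. -/
def Ex (As : ℕ → ℕ → Bool) (s : ℕ) (l : List ℕ) : Prop := ∃ σ ∈ strs s, T (As s) l σ

theorem Ex_prim {As : ℕ → ℕ → Bool} (hA : Primrec₂ As) : PrimrecRel (Ex As) := by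
  have h : PrimrecRel fun (σ : List Bool) (x : ℕ × List ℕ) => T (As x.1) x.2 σ :=
    T_prim hA (Primrec.fst.comp Primrec.snd) (Primrec.snd.comp Primrec.snd) Primrec.fst
  exact (h.exists_mem_list.comp (strs_prim.comp Primrec.fst) Primrec.id).of_eq fun x => Iff.rfl

open Classical in
/-- The next choice at stage `s`. -/
noncomputable def nxt (As : ℕ → ℕ → Bool) (s : ℕ) (l : List ℕ) : ℕ :=
  (List.range (s + 1)).findIdx fun c => decide (Ex As s (l ++ [c]))

theorem nxt_prim {As : ℕ → ℕ → Bool} (hA : Primrec₂ As) : Primrec₂ (nxt As) := by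
  classical
  refine Primrec.list_findIdx (f := fun x : ℕ × List ℕ => List.range (x.1 + 1))
    (p := fun x c => decide (Ex As x.1 (x.2 ++ [c])))
    (Primrec.list_range.comp (Primrec.succ.comp Primrec.fst)) ?_
  have : PrimrecPred fun y : (ℕ × List ℕ) × ℕ => Ex As y.1.1 (y.1.2 ++ [y.2]) :=
    (Ex_prim hA).comp (Primrec.fst.comp Primrec.fst)
      (Primrec.list_concat.comp (Primrec.snd.comp Primrec.fst) Primrec.snd)
  exact this.decide

/-- The approximation to the sequence of choices. -/
noncomputable def Ls (As : ℕ → ℕ → Bool) (s e : ℕ) : List ℕ :=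
  Nat.rec [] (fun _ l => l ++ [nxt As s l]) e

theorem Ls_prim {As : ℕ → ℕ → Bool} (hA : Primrec₂ As) : Primrec₂ (Ls As) := by
  have := Primrec.nat_rec (f := fun _ : ℕ => ([] : List ℕ))
    (g := fun s (x : ℕ × List ℕ) => x.2 ++ [nxt As s x.2]) (Primrec.const [])
    (Primrec.list_concat.comp (Primrec.snd.comp Primrec.snd)
      ((nxt_prim hA).comp Primrec.fst (Primrec.snd.comp Primrec.snd)))
  exact this

/-- The approximation to `Z`. -/
noncomputable def Zs (As : ℕ → ℕ → Bool) (s e : ℕ) : Bool := (nxt As s (Ls As s e)).bodd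

theorem Zs_prim {As : ℕ → ℕ → Bool} (hA : Primrec₂ As) : Primrec₂ (Zs As) :=
  Primrec.nat_bodd.comp ((nxt_prim hA).comp Primrec.fst (Ls_prim hA))

/-! ### The construction -/

/-- `Z` is a path through the tree. -/
def Path (B : ℕ → Bool) (l : List ℕ) (Z : ℕ → Bool) : Prop := ∀ k, T B l (restr Z k)

theorem T_append {B : ℕ → Bool} {l : List ℕ} {c : ℕ} {σ : List Bool} :
    T B (l ++ [c]) σ ↔ T B l σ ∧ (σ[l.length]? = none ∨ σ[l.length]? = some c.bodd) ∧
      G l.length σ c.div2 ≠ some (bv (B c.div2)) := by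
  have e1 : ∀ j < l.length, (l ++ [c]).getD j 0 = l.getD j 0 := by
    intro j hj
    exact List.getD_append _ _ _ _ hj
  have e2 : (l ++ [c]).getD l.length 0 = c := by simp
  constructor
  · rintro ⟨h1, h2⟩
    refine ⟨⟨h1, fun j hj => ?_⟩, ?_⟩
    · have := h2 j (by simp; omega)
      rwa [e1 j hj] at this
    · have := h2 l.length (by simp)
      rwa [e2] at this
  · rintro ⟨⟨h1, h2⟩, h3⟩
    refine ⟨h1, fun j hj => ?_⟩
    rcases Nat.lt_or_ge j l.length with h | h
    · rw [e1 j h]; exact h2 j h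
    · have : j = l.length := by simp at hj; omega
      subst this
      rw [e2]; exact h3

theorem T_congr {B B' : ℕ → Bool} {l : List ℕ}
    (h : ∀ j < l.length, B (l.getD j 0).div2 = B' (l.getD j 0).div2) (σ : List Bool) :
    T B l σ ↔ T B' l σ := by
  unfold T
  refine and_congr_right fun _ => forall₂_congr fun j hj => ?_
  rw [h j hj]

theorem eventually_agree {As : ℕ → ℕ → Bool} {A : ℕ → Bool} (hA : Approx As A) (l : List ℕ) :
    ∃ t, ∀ s ≥ t, ∀ σ, T (As s) l σ ↔ T A l σ := by
  choose f hf using hA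
  refine ⟨(Finset.range l.length).sup fun j => f (l.getD j 0).div2, fun s hs σ => ?_⟩
  apply T_congr
  intro j hj
  exact hf _ _ (le_trans (Finset.le_sup (f := fun j => f (l.getD j 0).div2)
    (Finset.mem_range.2 hj)) hs)

theorem bv_inj {a b : Bool} (h : bv a = bv b) : a = b := by
  cases a <;> cases b <;> simp_all [bv]

theorem extend {As : ℕ → ℕ → Bool} {A : ℕ → Bool} (hP : Primrec₂ As) (hA : Approx As A)
    (hinc : ¬ Computable A) {l : List ℕ} (h : ∃ Z, Path A l Z) :
    ∃ c, ∃ Z, Path A (l ++ [c]) Z := by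
  classical
  by_contra hno
  push Not at hno
  have c1 : ∀ n Z, Path A l Z → ∃ k, G l.length (restr Z k) n = some (bv (A n)) := by
    intro n Z hZ
    by_contra! hc
    apply hno (Nat.bit (Z l.length) n) Z
    intro k
    rw [T_append]
    refine ⟨hZ k, ?_, ?_⟩
    · rw [restr_getElem?, Nat.bodd_bit]
      split_ifs <;> simp
    · rw [Nat.div2_bit]; exact hc k
  obtain ⟨t, ht⟩ := eventually_agree hA l
  have ht := ht t le_rfl
  obtain ⟨Z, hZ⟩ := h
  let chk : ℕ → ℕ × Bool → Prop := fun s x =>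
    ∀ σ ∈ strs s, ¬ T (As t) l σ ∨ G l.length σ x.1 = some (bv x.2)
  have chk_prim : PrimrecRel chk := by
    have h1 : PrimrecRel fun (σ : List Bool) (x : ℕ × Bool) =>
        ¬ T (As t) l σ ∨ G l.length σ x.1 = some (bv x.2) := by
      refine PrimrecPred.or (PrimrecPred.not
        (T_prim hP (Primrec.const t) (Primrec.const l) Primrec.fst)) ?_
      exact Primrec.eq.comp (G_prim (Primrec.const _) Primrec.fst
        (Primrec.fst.comp Primrec.snd))
        (Primrec.option_some.comp (bv_prim.comp (Primrec.snd.comp Primrec.snd)))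
    exact (h1.forall_mem_list.comp (strs_prim.comp Primrec.fst) Primrec.snd).of_eq
      fun x => Iff.rfl
  have c2 : ∀ n, ∃ s, chk s (n, A n) := by
    intro n
    by_contra! hc
    obtain ⟨Y, hY⟩ := konig (fun σ => T A l σ ∧ G l.length σ n ≠ some (bv (A n)))
      (fun ρ σ hp hs => ⟨T_mono hp hs.1, fun hg => hs.2 (G_mono hp hg)⟩) (fun s => by
        have := hc s
        simp only [chk] at this
        push Not at this
        obtain ⟨σ, h1, h2, h3⟩ := this
        exact ⟨σ, mem_strs.1 h1, (ht σ).1 h2, h3⟩)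
    obtain ⟨k, hk⟩ := c1 n Y fun k => (hY k).1
    exact (hY k).2 hk
  have c3 : ∀ n s b, chk s (n, b) → b = A n := by
    intro n s b hb
    obtain ⟨k, hk⟩ := c1 n Z hZ
    have h1 : G l.length (restr Z s) n = some (bv b) := by
      rcases hb (restr Z s) (mem_strs.2 (restr_length _ _)) with h | h
      · exact absurd ((ht _).2 (hZ s)) h
      · exact h
    have h2 := G_mono (restr_pre Z (le_max_left k s)) hk
    have h3 := G_mono (restr_pre Z (le_max_right k s)) h1
    rw [h2] at h3
    exact (bv_inj (Option.some.inj h3)).symm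
  apply hinc
  have q1 : Primrec₂ fun (n s : ℕ) => decide (chk s (n, true)) :=
    (chk_prim.comp Primrec.snd (Primrec.pair Primrec.fst (Primrec.const true))).decide
  have q2 : Primrec₂ fun (n s : ℕ) => decide (chk s (n, false)) :=
    (chk_prim.comp Primrec.snd (Primrec.pair Primrec.fst (Primrec.const false))).decide
  have q3 : Partrec fun n => (Nat.rfind fun s =>
      (Part.some (decide (chk s (n, true)) || decide (chk s (n, false))))).map
        fun s => decide (chk s (n, true)) :=
    (Partrec.rfind (p := fun n s =>
      Part.some (decide (chk s (n, true)) || decide (chk s (n, false))))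
      (Primrec.or.comp q1 q2).to_comp.partrec).map q1.to_comp
  refine q3.of_eq_tot fun n => ?_
  obtain ⟨s, hs⟩ := c2 n
  obtain ⟨m, hm, -⟩ := Nat.rfind_min'
    (p := fun s => decide (chk s (n, true)) || decide (chk s (n, false))) (m := s)
    (by cases hn : A n <;> rw [hn] at hs <;> simp [hs])
  rw [Part.mem_map_iff]
  refine ⟨m, hm, ?_⟩
  have h0 := Part.mem_some_iff.1 (Nat.rfind_spec hm)
  have : chk m (n, true) ∨ chk m (n, false) := by
    simpa only [Bool.or_eq_true, decide_eq_true_eq] using h0.symm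
  rcases this with h | h
  · rw [← c3 n m true h]; simpa using h
  · rw [← c3 n m false h]
    simp only [decide_eq_false_iff_not]
    intro h'
    have a := c3 n m true h'
    rw [← c3 n m false h] at a
    cases a

open Classical in
/-- The true next choice. -/
noncomputable def nx (A : ℕ → Bool) (l : List ℕ) : ℕ :=
  if h : ∃ c, ∃ Z, Path A (l ++ [c]) Z then Nat.find h else 0

/-- The true sequence of choices. -/
noncomputable def Lst (A : ℕ → Bool) (e : ℕ) : List ℕ :=
  Nat.rec [] (fun _ l => l ++ [nx A l]) e

theorem Lst_succ (A : ℕ → Bool) (e : ℕ) : Lst A (e + 1) = Lst A e ++ [nx A (Lst A e)] := rfl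

theorem Ls_succ (As : ℕ → ℕ → Bool) (s e : ℕ) :
    Ls As s (e + 1) = Ls As s e ++ [nxt As s (Ls As s e)] := rfl

theorem Lst_length (A : ℕ → Bool) (e : ℕ) : (Lst A e).length = e := by
  induction e with
  | zero => rfl
  | succ e ih => rw [Lst_succ]; simp [ih]

theorem Lst_path {As : ℕ → ℕ → Bool} {A : ℕ → Bool} (hP : Primrec₂ As) (hA : Approx As A)
    (hinc : ¬ Computable A) (e : ℕ) : ∃ Z, Path A (Lst A e) Z := by
  classical
  induction e with
  | zero =>
    exact konig (T A []) (fun _ _ => T_mono) fun s => by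
      obtain ⟨σ, h1, h2⟩ := MlOK_exists s
      exact ⟨σ, h1, h2, by simp⟩
  | succ e ih =>
    have h := extend hP hA hinc ih
    rw [Lst_succ, nx, dif_pos h]
    exact Nat.find_spec h

theorem T_Lst_mono {A : ℕ → Bool} {d e : ℕ} (h : d ≤ e) {σ : List Bool} (hT : T A (Lst A e) σ) :
    T A (Lst A d) σ := by
  induction e, h using Nat.le_induction with
  | base => exact hT
  | succ e _ ih => rw [Lst_succ, T_append] at hT; exact ih hT.1

/-- The random set. -/
noncomputable def ZZ (A : ℕ → Bool) (e : ℕ) : Bool := (nx A (Lst A e)).bodd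

theorem ZZ_path {As : ℕ → ℕ → Bool} {A : ℕ → Bool} (hP : Primrec₂ As) (hA : Approx As A)
    (hinc : ¬ Computable A) (e : ℕ) : Path A (Lst A e) (ZZ A) := by
  intro k
  obtain ⟨Y, hY⟩ := Lst_path hP hA hinc (max e k)
  have : ∀ i < k, Y i = ZZ A i := by
    intro i hi
    have h1 := T_Lst_mono (d := i + 1) (by omega) (hY (i + 1))
    rw [Lst_succ, T_append, Lst_length, restr_getElem?, if_pos (Nat.lt_succ_self i)] at h1
    simpa [ZZ] using h1.2.1
  rw [← restr_congr this]
  exact T_Lst_mono (le_max_left _ _) (hY k)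

theorem Ex_limit {As : ℕ → ℕ → Bool} {A : ℕ → Bool} (hA : Approx As A) (l : List ℕ) :
    ∃ t, ∀ s ≥ t, (Ex As s l ↔ ∃ Z, Path A l Z) := by
  obtain ⟨t, ht⟩ := eventually_agree hA l
  by_cases h : ∃ Z, Path A l Z
  · refine ⟨t, fun s hs => iff_of_true ?_ h⟩
    obtain ⟨Z, hZ⟩ := h
    exact ⟨restr Z s, mem_strs.2 (restr_length _ _), (ht s hs _).2 (hZ s)⟩
  · have : ∃ s, ∀ σ : List Bool, σ.length = s → ¬ T A l σ := by
      by_contra! hc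
      exact h (konig (T A l) (fun _ _ => T_mono) hc)
    obtain ⟨s0, hs0⟩ := this
    refine ⟨max t s0, fun s hs => iff_of_false ?_ h⟩
    rintro ⟨σ, h1, h2⟩
    rw [mem_strs] at h1
    refine hs0 (σ.take s0) (by simp; omega) (T_mono ⟨_, List.take_append_drop _ _⟩ ?_)
    exact (ht s (by omega) σ).1 h2

theorem nxt_limit {As : ℕ → ℕ → Bool} {A : ℕ → Bool} (hA : Approx As A) (l : List ℕ)
    (h : ∃ c, ∃ Z, Path A (l ++ [c]) Z) : ∃ t, ∀ s ≥ t, nxt As s l = nx A l := by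
  classical
  choose f hf using fun c => Ex_limit hA (l ++ [c])
  refine ⟨max (nx A l) ((Finset.range (nx A l + 1)).sup f), fun s hs => ?_⟩
  have hf' : ∀ c ≤ nx A l, (Ex As s (l ++ [c]) ↔ ∃ Z, Path A (l ++ [c]) Z) := fun c hc =>
    hf c s (le_trans (le_trans (Finset.le_sup (f := f) (Finset.mem_range.2 (by omega)))
      (le_max_right _ _)) hs)
  have hle : nx A l ≤ s := le_trans (le_max_left _ _) hs
  unfold nxt
  rw [List.findIdx_eq (by simp; omega)]
  have hfind : nx A l = Nat.find h := by rw [nx, dif_pos h]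
  constructor
  · simp only [List.getElem_range, decide_eq_true_eq]
    rw [hf' _ le_rfl, hfind]
    exact Nat.find_spec h
  · intro j hj
    simp only [List.getElem_range, decide_eq_false_iff_not]
    rw [hf' _ hj.le]
    exact Nat.find_min h (hfind ▸ hj)

theorem Ls_limit {As : ℕ → ℕ → Bool} {A : ℕ → Bool} (hP : Primrec₂ As) (hA : Approx As A)
    (hinc : ¬ Computable A) (e : ℕ) : ∃ t, ∀ s ≥ t, Ls As s e = Lst A e := by
  induction e with
  | zero => exact ⟨0, fun _ _ => rfl⟩
  | succ e ih =>
    obtain ⟨t, ht⟩ := ih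
    obtain ⟨u, hu⟩ := nxt_limit hA (Lst A e) (extend hP hA hinc (Lst_path hP hA hinc e))
    refine ⟨max t u, fun s hs => ?_⟩
    rw [Ls_succ, Lst_succ, ht s (by omega), hu s (by omega)]

theorem main {As : ℕ → ℕ → Bool} {A : ℕ → Bool} (hP : Primrec₂ As) (hA : Approx As A)
    (hinc : ¬ Computable A) : ∃ Z : ℕ → Bool, MLRandom Z ∧ Delta02 Z ∧ ¬ TuringLE A Z := by
  refine ⟨ZZ A, ?_, ⟨Zs As, (Zs_prim hP).to_comp, ?_⟩, ?_⟩
  · exact mlrandom_of_MlOK fun k => (ZZ_path hP hA hinc 0 k).1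
  · intro e
    obtain ⟨t, ht⟩ := Ls_limit hP hA hinc e
    obtain ⟨u, hu⟩ := nxt_limit hA (Lst A e) (extend hP hA hinc (Lst_path hP hA hinc e))
    refine ⟨max t u, fun s hs => ?_⟩
    rw [Zs, ZZ, ht s (by omega), hu s (by omega)]
  · intro hT
    obtain ⟨g, hg, hr⟩ := use_principle (ZZ A) hT
    have hg' : Partrec fun m : ℕ => g ((Encodable.decode (α := List Bool) m.unpair.1).getD [])
        m.unpair.2 :=
      hg.comp ((Primrec.option_getD.comp (Primrec.decode.comp (unpair1_prim Primrec.id))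
        (Primrec.const [])).to_comp) (unpair2_prim Primrec.id).to_comp
    obtain ⟨c, hc⟩ := Nat.Partrec.Code.exists_code.1 (Partrec.nat_iff.1 hg')
    have hce : ∀ (σ : List Bool) n, c.eval (Nat.pair (Encodable.encode σ) n) = g σ n := by
      intro σ n; rw [hc]; simp
    set e := Encodable.encode c with he
    have hofe : Denumerable.ofNat Nat.Partrec.Code e = c := by simp [he]
    set n := (nx A (Lst A e)).div2 with hn
    have hno : ∀ k, G e (restr (ZZ A) k) n ≠ some (bv (A n)) := by
      intro k
      have := ZZ_path hP hA hinc (e + 1) k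
      rw [Lst_succ, T_append, Lst_length] at this
      exact this.2.2
    -- the computation converges
    have hmem : bv (A n) ∈ charFn A n := by simp [charFn, bv]
    obtain ⟨k, hk⟩ := ((hr n).2 _).1 hmem
    replace hk : bv (A n) ∈ g (restr (ZZ A) k) n := hk
    rw [← hce] at hk
    obtain ⟨u, hu⟩ := Nat.Partrec.Code.evaln_complete.1 hk
    have htake : ∀ j m, j ≤ m → (restr (ZZ A) m).take j = restr (ZZ A) j := by
      intro j m hjm
      have h2 := List.prefix_iff_eq_take.1 (restr_pre (ZZ A) hjm)
      rw [restr_length] at h2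
      exact h2.symm
    -- any value found is correct
    have hval : ∀ m y, G e (restr (ZZ A) m) n = some y → y = bv (A n) := by
      intro m y hy
      unfold G at hy
      obtain ⟨t, ht, hty⟩ := List.exists_of_findSome?_eq_some hy
      rw [List.mem_range, restr_length] at ht
      rw [hofe, htake _ _ (by have := Nat.unpair_left_le t; omega)] at hty
      have h1 := Nat.Partrec.Code.evaln_sound (Option.mem_def.2 hty)
      rw [hce] at h1
      have h2 := ((hr n).2 y).2 ⟨_, h1⟩
      exact Part.mem_unique h2 hmem
    have hsome : (G e (restr (ZZ A) (Nat.pair k u)) n).isSome := by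
      unfold G
      rw [List.findSome?_isSome_iff]
      refine ⟨Nat.pair k u, by simp [restr_length], ?_⟩
      rw [hofe]
      simp only [Nat.unpair_pair]
      rw [htake _ _ (Nat.left_le_pair k u), Option.mem_def.1 hu]
      rfl
    obtain ⟨y, hy⟩ := Option.isSome_iff_exists.1 hsome
    have := hval _ _ hy
    subst this
    exact hno _ hy

theorem ce_approx {A : ℕ → Bool} (h : CE A) : ∃ As, Primrec₂ As ∧ Approx As A := by
  obtain ⟨f, hf, hA⟩ := h
  obtain ⟨c, rfl⟩ := Nat.Partrec.Code.exists_code.1 hf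
  refine ⟨fun s x => (Nat.Partrec.Code.evaln s c x).isSome, ?_, ?_⟩
  · exact Primrec.option_isSome.comp (Nat.Partrec.Code.primrec_evaln.comp
      (Primrec.pair (Primrec.pair Primrec.fst (Primrec.const c)) Primrec.snd))
  · intro x
    cases hx : A x with
    | true =>
      have hd := (hA x).1 hx
      obtain ⟨k, hk⟩ := Nat.Partrec.Code.evaln_complete.1 (Part.get_mem hd)
      refine ⟨k, fun s hs => ?_⟩
      show (Nat.Partrec.Code.evaln s c x).isSome = true
      rw [Option.mem_def.1 (Nat.Partrec.Code.evaln_mono hs hk)]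
      rfl
    | false =>
      refine ⟨0, fun s _ => ?_⟩
      by_contra hne
      have hsome : (Nat.Partrec.Code.evaln s c x).isSome = true :=
        Option.isSome_iff_ne_none.2 (by simpa using hne)
      obtain ⟨y, hy⟩ := Option.isSome_iff_exists.1 hsome
      have h1 := Nat.Partrec.Code.evaln_sound (Option.mem_def.2 hy)
      have := (hA x).2 (Part.dom_iff_mem.2 ⟨y, h1⟩)
      rw [hx] at this
      cases this

end RAUC

/-- For every incomputable c.e. set `A` there is a ML-random Δ⁰₂ set
not above `A`. -/
theorem random_avoiding_upper_cone (A : ℕ → Bool) (hce : CE A)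
    (hinc : ¬ Computable A) :
    ∃ Z : ℕ → Bool, MLRandom Z ∧ Delta02 Z ∧ ¬ TuringLE A Z := by
  obtain ⟨As, hP, hA⟩ := RAUC.ce_approx hce
  exact RAUC.main hP hA hinc
end
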